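/- Let Ω ⊂ ℝⁿ be an open bounded domain, assume the standing assumptions, let ε ∈ (0,1) and v ∈ C(Ω̄), and consider the regularized equation G_ε(x, Du)(ε u + F(D²u)) = f(x) in Ω. If w₁ : Ω̄ → ℝ is upper semicontinuous on Ω̄ and a viscosity subsolution of the regularized equation in Ω, w₂ : Ω̄ → ℝ is lower semicontinuous on Ω̄ and a viscosity supersolution of the regularized equation in Ω, and w₁ ≤ w₂ on ∂Ω, then w₁ ≤ w₂ in Ω. -/

import Mathlib

open Metric Set MeasureTheory Topology

noncomputable section

abbrev En (n : ℕ) : Type := EuclideanSpace ℝ (Fin n)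
abbrev Mat (n : ℕ) : Type := Matrix (Fin n) (Fin n) ℝ

/-- `F : 𝒮(n) → ℝ` is uniformly `(λ,Λ)`-elliptic:
for all symmetric `A, B` with `B` positive semidefinite,
`λ·tr B ≤ F A − F (A + B) ≤ Λ·tr B`. -/
def UniformlyElliptic {n : ℕ} (lam Lam : ℝ) (F : Mat n → ℝ) : Prop :=
  Continuous F ∧
    ∀ A B : Mat n, A.IsSymm → B.IsSymm → B.PosSemidef →
      lam * B.trace ≤ F A - F (A + B) ∧ F A - F (A + B) ≤ Lam * B.trace

/-- The Hessian matrix of `φ` at `x`, in the standard basis of `ℝⁿ`. -/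
def hessianMatrix {n : ℕ} (φ : En n → ℝ) (x : En n) : Mat n :=
  Matrix.of fun i j =>
    iteratedFDeriv ℝ 2 φ x ![EuclideanSpace.single i (1 : ℝ), EuclideanSpace.single j (1 : ℝ)]

/-- `w` is a viscosity subsolution of `G(x, u(x), Du, D²u) = 0` on `Ω`:
whenever a `C²` function `φ` is such that `w − φ` has a local maximum (on `Ω`) at `x₀ ∈ Ω`,
then `G x₀ (w x₀) (Dφ x₀) (D²φ x₀) ≤ 0`. -/
def ViscSubOn {n : ℕ} (Ω : Set (En n)) (G : En n → ℝ → En n → Mat n → ℝ)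
    (w : En n → ℝ) : Prop :=
  ∀ φ : En n → ℝ, ContDiff ℝ 2 φ → ∀ x₀ ∈ Ω,
    IsLocalMaxOn (fun x => w x - φ x) Ω x₀ →
      G x₀ (w x₀) (gradient φ x₀) (hessianMatrix φ x₀) ≤ 0

/-- `w` is a viscosity supersolution of `G(x, u(x), Du, D²u) = 0` on `Ω`. -/
def ViscSupOn {n : ℕ} (Ω : Set (En n)) (G : En n → ℝ → En n → Mat n → ℝ)
    (w : En n → ℝ) : Prop :=
  ∀ φ : En n → ℝ, ContDiff ℝ 2 φ → ∀ x₀ ∈ Ω,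
    IsLocalMinOn (fun x => w x - φ x) Ω x₀ →
      0 ≤ G x₀ (w x₀) (gradient φ x₀) (hessianMatrix φ x₀)

/-- viscosity solution: both a subsolution and a supersolution. -/
def ViscSolOn {n : ℕ} (Ω : Set (En n)) (G : En n → ℝ → En n → Mat n → ℝ)
    (u : En n → ℝ) : Prop :=
  ViscSubOn Ω G u ∧ ViscSupOn Ω G u

/-- `H(x, z; ξ) = |ξ+z|^p + coef(x)·|ξ+z|^e`. -/
def Hfun {n : ℕ} (p e : ℝ) (coef : En n → ℝ) (ξ x z : En n) : ℝ :=
  ‖ξ + z‖ ^ p + coef x * ‖ξ + z‖ ^ e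

/-- The switched exponent `p_v(x) = p⁺·1_{v>0}(x) + p⁻·1_{v<0}(x)`. -/
def pSwitch {n : ℕ} (pp pm : ℝ) (v : En n → ℝ) (x : En n) : ℝ :=
  pp * Set.indicator {y | 0 < v y} (fun _ => (1 : ℝ)) x
    + pm * Set.indicator {y | v y < 0} (fun _ => (1 : ℝ)) x

/-- The transmission operator
`[|ξ+z|^{p_v(x)} + a(x)1_{v>0}|ξ+z|^q + b(x)1_{v<0}|ξ+z|^s]·F(X) − f(x)`. -/
def transOp {n : ℕ} (F : Mat n → ℝ) (pp pm q s : ℝ) (a b f v : En n → ℝ) (ξ : En n) :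
    En n → ℝ → En n → Mat n → ℝ :=
  fun x _ z X =>
    (‖ξ + z‖ ^ pSwitch pp pm v x
        + a x * Set.indicator {y | 0 < v y} (fun _ => (1 : ℝ)) x * ‖ξ + z‖ ^ q
        + b x * Set.indicator {y | v y < 0} (fun _ => (1 : ℝ)) x * ‖ξ + z‖ ^ s) * F X - f x

/-- `min{F(X), H_q(x,z;ξ)F(X), H_s(x,z;ξ)F(X)} − rhs(x)`. -/
def minOp {n : ℕ} (F : Mat n → ℝ) (pp pm q s : ℝ) (a b : En n → ℝ) (ξ : En n)
    (rhs : En n → ℝ) : En n → ℝ → En n → Mat n → ℝ :=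
  fun x _ z X =>
    min (F X) (min (Hfun pp q a ξ x z * F X) (Hfun pm s b ξ x z * F X)) - rhs x

/-- `max{F(X), H_q(x,z;ξ)F(X), H_s(x,z;ξ)F(X)} − rhs(x)`. -/
def maxOp {n : ℕ} (F : Mat n → ℝ) (pp pm q s : ℝ) (a b : En n → ℝ) (ξ : En n)
    (rhs : En n → ℝ) : En n → ℝ → En n → Mat n → ℝ :=
  fun x _ z X =>
    max (F X) (max (Hfun pp q a ξ x z * F X) (Hfun pm s b ξ x z * F X)) - rhs x

/-- Definition D: `u` is a viscosity solution of the free transmission equation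
relative to the sign of `v`, with translation vector `ξ`. -/
def DefDSolution {n : ℕ} (Ω : Set (En n)) (F : Mat n → ℝ) (pp pm q s : ℝ)
    (a b f : En n → ℝ) (v : En n → ℝ) (ξ : En n) (u : En n → ℝ) : Prop :=
  ViscSolOn ({x ∈ Ω | 0 < v x} ∪ {x ∈ Ω | v x < 0}) (transOp F pp pm q s a b f v ξ) u ∧
  ViscSubOn {x ∈ Ω | v x = 0} (minOp F pp pm q s a b ξ f) u ∧
  ViscSupOn {x ∈ Ω | v x = 0} (maxOp F pp pm q s a b ξ f) u

/-- Uniform exterior sphere condition for `Ω`. -/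
def UnifExtSphere {n : ℕ} (Ω : Set (En n)) : Prop :=
  ∃ r : ℝ, 0 < r ∧ ∀ y ∈ frontier Ω, ∃ x : En n,
    dist y x = r ∧ Metric.closedBall x r ∩ closure Ω = {y}

/-- `φ` is a smooth, nonnegative, radially symmetric mollifier supported in `B_ε(0)`
with unit mass. -/
def IsMollifier {n : ℕ} (ε : ℝ) (φ : En n → ℝ) : Prop :=
  ContDiff ℝ (⊤ : ℕ∞) φ ∧ (∀ x, 0 ≤ φ x) ∧ (∀ x y : En n, ‖x‖ = ‖y‖ → φ x = φ y) ∧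
    (∫ x, φ x) = 1 ∧ ∀ x : En n, ε ≤ ‖x‖ → φ x = 0

/-- The mollified indicator `(φε * 1_S)(x)`. -/
def smoothedChi {n : ℕ} (φε : En n → ℝ) (S : Set (En n)) (x : En n) : ℝ :=
  ∫ y, φε y * S.indicator (fun _ => (1 : ℝ)) (x - y)

/-- `ℓ_μ(z) = √(μ² + |z|²)`. -/
def ellReg {n : ℕ} (μ : ℝ) (z : En n) : ℝ := Real.sqrt (μ ^ 2 + ‖z‖ ^ 2)

/-- The regularized operator
`G_ε(x, z)·(ε·r + F(X)) − f(x)`, where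
`G_ε(x,z) = ℓ_ε(z)^{p_{ε;v}(x)} + a_{ε;v}(x) ℓ_ε(z)^q + b_{ε;v}(x) ℓ_ε(z)^s`. -/
def regOp {n : ℕ} (F : Mat n → ℝ) (ε pp pm q s : ℝ) (a b v f φε : En n → ℝ) :
    En n → ℝ → En n → Mat n → ℝ :=
  fun x r z X =>
    (ellReg ε z ^ (ε + pp * smoothedChi φε {y | 0 < v y} x + pm * smoothedChi φε {y | v y < 0} x)
        + (ε + a x * smoothedChi φε {y | 0 < v y} x) * ellReg ε z ^ q
        + (ε + b x * smoothedChi φε {y | v y < 0} x) * ellReg ε z ^ s) * (ε * r + F X) - f x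

/-- The Multi-Phase operator with variable exponents:
`[ℓ_μ(z)^{p(x)} + a(x)ℓ_μ(z)^{q(x)} + b(x)ℓ_μ(z)^{s(x)}]·(μ·r + F(X)) − f(x)`. -/
def mpOp {n : ℕ} (F : Mat n → ℝ) (μ : ℝ) (p q s a b f : En n → ℝ) :
    En n → ℝ → En n → Mat n → ℝ :=
  fun x r z X =>
    (ellReg μ z ^ p x + a x * ellReg μ z ^ q x + b x * ellReg μ z ^ s x) * (μ * r + F X) - f x

/-- Pucci maximal operator `M⁺_{λ,Λ}(A) = −Λ·tr(A⁻) − λ·tr(A⁺)`. -/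
def pucciPlus {n : ℕ} (lam Lam : ℝ) (A : Mat n) : ℝ :=
  if h : A.IsHermitian then
    -(Lam * ∑ i, min (h.eigenvalues i) 0) - lam * ∑ i, max (h.eigenvalues i) 0
  else 0

/-- Pucci minimal operator `M⁻_{λ,Λ}(A) = −Λ·tr(A⁺) − λ·tr(A⁻)`. -/
def pucciMinus {n : ℕ} (lam Lam : ℝ) (A : Mat n) : ℝ :=
  if h : A.IsHermitian then
    -(Lam * ∑ i, max (h.eigenvalues i) 0) - lam * ∑ i, min (h.eigenvalues i) 0
  else 0

/-- `u` is locally `β`-Hölder continuous on `Ω`. -/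
def LocallyHolderOn {n : ℕ} (Ω : Set (En n)) (β : ℝ) (u : En n → ℝ) : Prop :=
  ∀ x ∈ Ω, ∃ ε > 0, ∃ C : ℝ, ∀ y ∈ ball x ε ∩ Ω, ∀ z ∈ ball x ε ∩ Ω,
    |u y - u z| ≤ C * ‖y - z‖ ^ β

/-- `u ∈ C^{1,α}_loc(Ω)`: `u` is differentiable on `Ω` with locally
`α`-Hölder continuous gradient. -/
def C1HolderLocOn {n : ℕ} (Ω : Set (En n)) (α : ℝ) (u : En n → ℝ) : Prop :=
  (∀ x ∈ Ω, DifferentiableAt ℝ u x) ∧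
  ∀ x ∈ Ω, ∃ ε > 0, ∃ C : ℝ, ∀ y ∈ ball x ε ∩ Ω, ∀ z ∈ ball x ε ∩ Ω,
    ‖gradient u y - gradient u z‖ ≤ C * ‖y - z‖ ^ α

section SC
variable {E : Type*} [NormedAddCommGroup E] [InnerProductSpace ℝ E]

lemma cp_scal {a b s r : ℝ} (hs : 0 < s) (hr : 0 < r) :
    (a + b) ^ 2 / (2 * (s + r)) ≤ a ^ 2 / (2 * s) + b ^ 2 / (2 * r) := by
  rw [div_add_div _ _ (by positivity) (by positivity), div_le_div_iff₀ (by positivity) (by positivity)]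
  have h := mul_nonneg (mul_nonneg hs.le hr.le) (sq_nonneg (a * r - b * s))
  have h1 := sq_nonneg (a * r - b * s)
  nlinarith [h1, hs, hr]

lemma cp_q1 {s r : ℝ} (hs : 0 < s) (hr : 0 < r) (x y : E) :
    ‖x + y‖ ^ 2 / (2 * (s + r)) ≤ ‖x‖ ^ 2 / (2 * s) + ‖y‖ ^ 2 / (2 * r) := by
  refine le_trans ?_ (cp_scal hs hr)
  gcongr
  exact norm_add_le x y

/-- sup-convolution -/
def IsSupC (N : Set E) (u : E → ℝ) (t : ℝ) (U : E → ℝ) : Prop :=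
  (∀ x, ∀ y ∈ N, u y - ‖x - y‖ ^ 2 / (2 * t) ≤ U x) ∧
  ∀ x, ∃ y ∈ N, U x = u y - ‖x - y‖ ^ 2 / (2 * t)

/-- inf-convolution -/
def IsInfC (U : E → ℝ) (s : ℝ) (R : E → ℝ) : Prop :=
  (∀ x y, R y ≤ U x + ‖x - y‖ ^ 2 / (2 * s)) ∧
  ∀ y, ∃ x, R y = U x + ‖x - y‖ ^ 2 / (2 * s)

lemma exists_supC {N : Set E} (hN : IsCompact N) (hne : N.Nonempty) {u : E → ℝ}
    (hu : UpperSemicontinuousOn u N) (t : ℝ) : ∃ U, IsSupC N u t U := by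
  have key : ∀ x, ∃ y ∈ N, IsMaxOn (fun y => u y - ‖x - y‖ ^ 2 / (2 * t)) N y := by
    intro x
    apply UpperSemicontinuousOn.exists_isMaxOn hne hN
    have hc : ContinuousOn (fun y => - (‖x - y‖ ^ 2 / (2 * t))) N := by fun_prop
    have := UpperSemicontinuousOn.add hu hc.upperSemicontinuousOn
    simpa [sub_eq_add_neg] using this
  choose y hy hm using key
  refine ⟨fun x => u (y x) - ‖x - y x‖ ^ 2 / (2 * t), fun x z hz => hm x hz, fun x => ⟨y x, hy x, rfl⟩⟩

lemma IsSupC.lsc {N : Set E} {u U : E → ℝ} {t : ℝ} (h : IsSupC N u t U) :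
    LowerSemicontinuous U := by
  intro x c hc
  obtain ⟨y, hy, e⟩ := h.2 x
  have hcont : Continuous (fun x' : E => u y - ‖x' - y‖ ^ 2 / (2 * t)) := by fun_prop
  rw [e] at hc
  have := hcont.continuousAt.eventually (lt_mem_nhds hc)
  filter_upwards [this] with x' hx'
  exact lt_of_lt_of_le hx' (h.1 x' y hy)

lemma exists_infC [FiniteDimensional ℝ E] {N : Set E} {u U : E → ℝ} {t s : ℝ}
    (h : IsSupC N u t U) (hs : 0 < s) (hst : s < t) : ∃ R, IsInfC U s R := by
  have key : ∀ y, ∃ x, ∀ x', U x + ‖x - y‖ ^ 2 / (2 * s) ≤ U x' + ‖x' - y‖ ^ 2 / (2 * s) := by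
    intro y
    obtain ⟨z, hz, -⟩ := h.2 y
    have hlsc : LowerSemicontinuous (fun x => U x + ‖x - y‖ ^ 2 / (2 * s)) := by
      have hc : Continuous (fun x : E => ‖x - y‖ ^ 2 / (2 * s)) := by fun_prop
      exact h.lsc.add hc.lowerSemicontinuous
    -- coercivity
    have hlow : ∀ x, u z - ‖x - z‖ ^ 2 / (2 * t) + ‖x - y‖ ^ 2 / (2 * s) ≤
        U x + ‖x - y‖ ^ 2 / (2 * s) := fun x => by linarith [h.1 x z hz]
    have htend : Filter.Tendsto (fun x => U x + ‖x - y‖ ^ 2 / (2 * s)) (Filter.cocompact E)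
        Filter.atTop := by
      refine Filter.tendsto_atTop_mono hlow ?_
      have e : (t - s) > 0 := by linarith
      set m : ℝ := (s + t) / 2 with hm
      have hsm : s < m := by rw [hm]; linarith
      have hmt : m < t := by rw [hm]; linarith
      have hl2 : ∀ x, u z - ‖y - z‖ ^ 2 / (2 * (t - m)) + (1 / (2 * s) - 1 / (2 * m)) * ‖x - y‖ ^ 2
          ≤ u z - ‖x - z‖ ^ 2 / (2 * t) + ‖x - y‖ ^ 2 / (2 * s) := by
        intro x
        have := cp_q1 (s := m) (r := t - m) (by linarith) (by linarith) (x - y) (y - z)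
        rw [sub_add_sub_cancel, add_sub_cancel] at this
        have e2 : (1 / (2 * s) - 1 / (2 * m)) * ‖x - y‖ ^ 2 = ‖x - y‖ ^ 2 / (2 * s) - ‖x - y‖ ^ 2 / (2 * m) := by ring
        rw [e2]; linarith
      refine Filter.tendsto_atTop_mono hl2 ?_
      apply Filter.tendsto_atTop_add_const_left
      apply Filter.Tendsto.const_mul_atTop
      · rw [sub_pos]; apply one_div_lt_one_div_of_lt <;> linarith
      · have h1 : Filter.Tendsto (fun x : E => ‖x - y‖) (Filter.cocompact E) Filter.atTop := by
          have := tendsto_norm_cocompact_atTop (E := E)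
          refine Filter.tendsto_atTop_mono (f := fun x : E => ‖x‖ + (-‖y‖)) (fun x => ?_)
            (Filter.tendsto_atTop_add_const_right _ _ this)
          have := norm_sub_norm_le x y
          linarith
        exact (Filter.tendsto_pow_atTop (by norm_num)).comp h1
    have hev := htend.eventually (Filter.eventually_ge_atTop (U y + ‖y - y‖ ^ 2 / (2 * s)))
    obtain ⟨K, hK, hK2⟩ := Filter.mem_cocompact.1 hev
    obtain ⟨x, -, hx⟩ := LowerSemicontinuousOn.exists_isMinOn (s := insert y K) ⟨y, by simp⟩
      (hK.insert y) (hlsc.lowerSemicontinuousOn _)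
    refine ⟨x, fun x' => ?_⟩
    by_cases hx' : x' ∈ K
    · exact hx (Set.mem_insert_of_mem _ hx')
    · exact le_trans (hx (Set.mem_insert y K)) (hK2 hx')
  choose x hx using key
  exact ⟨fun y => U (x y) + ‖x y - y‖ ^ 2 / (2 * s), fun x' y => hx y x', fun y => ⟨x y, rfl⟩⟩

lemma IsSupC.mid {N : Set E} {u U : E → ℝ} {t : ℝ} (h : IsSupC N u t U) (x k : E) :
    2 * U x - 2 * (‖k‖ ^ 2 / (2 * t)) ≤ U (x + k) + U (x - k) := by
  obtain ⟨y, hy, e⟩ := h.2 x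
  have h1 := h.1 (x + k) y hy
  have h2 := h.1 (x - k) y hy
  have h3 : ‖x + k - y‖ ^ 2 + ‖x - k - y‖ ^ 2 = 2 * ‖x - y‖ ^ 2 + 2 * ‖k‖ ^ 2 := by
    have := parallelogram_law_with_norm ℝ (x - y) k
    rw [show x + k - y = x - y + k by abel, show x - k - y = x - y - k by abel]
    nlinarith
  have h4 : ‖x + k - y‖ ^ 2 / (2 * t) + ‖x - k - y‖ ^ 2 / (2 * t) = 2 * (‖x - y‖ ^ 2 / (2 * t)) + 2 * (‖k‖ ^ 2 / (2 * t)) := by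
    rw [← add_div, h3]; ring
  rw [e]; linarith

lemma IsInfC.mid {N : Set E} {u U R : E → ℝ} {t s : ℝ} (h : IsSupC N u t U) (h' : IsInfC U s R)
    (hs : 0 < s) (hst : s < t) (y k : E) :
    2 * R y - ‖k‖ ^ 2 / (t - s) ≤ R (y + k) + R (y - k) := by
  obtain ⟨a, ha⟩ := h'.2 (y + k)
  obtain ⟨b, hb⟩ := h'.2 (y - k)
  set x : E := (1 / 2 : ℝ) • (a + b) with hx
  set j : E := (1 / 2 : ℝ) • (a - b) with hj
  have ea : a = x + j := by rw [hx, hj, ← smul_add]; simp [← two_smul ℝ]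
  have eb : b = x - j := by rw [hx, hj, ← smul_sub]; simp [← two_smul ℝ]
  have h1 := h.mid x j
  rw [← ea, ← eb] at h1
  have h2 := h'.1 x y
  have h3 : ‖a - (y + k)‖ ^ 2 + ‖b - (y - k)‖ ^ 2 = 2 * ‖x - y‖ ^ 2 + 2 * ‖j - k‖ ^ 2 := by
    have := parallelogram_law_with_norm ℝ (x - y) (j - k)
    rw [show a - (y + k) = x - y + (j - k) by rw [ea]; abel,
      show b - (y - k) = x - y - (j - k) by rw [eb]; abel]
    nlinarith
  have h4 : ‖a - (y + k)‖ ^ 2 / (2 * s) + ‖b - (y - k)‖ ^ 2 / (2 * s) = 2 * (‖x - y‖ ^ 2 / (2 * s)) + 2 * (‖j - k‖ ^ 2 / (2 * s)) := by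
    rw [← add_div, h3]; ring
  have h5 := cp_q1 (s := s) (r := t - s) hs (by linarith) (j - k) k
  rw [sub_add_cancel, add_sub_cancel] at h5
  have h6 : ‖k‖ ^ 2 / (t - s) = 2 * (‖k‖ ^ 2 / (2 * (t - s))) := by
    have : t - s ≠ 0 := by linarith
    field_simp
  rw [ha, hb, h6]; linarith

/-- regularity of functions with one-sided paraboloids and midpoint semiconvexity -/
lemma cp_reg {R : E → ℝ} {A c : ℝ} (hA : 0 ≤ A) (hc : 0 ≤ c)
    (hup : ∀ y, ∃ p : E, ∀ y', R y' ≤ R y + inner ℝ p (y' - y) + A * ‖y' - y‖ ^ 2)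
    (hmid : ∀ y k, 2 * R y - c * ‖k‖ ^ 2 ≤ R (y + k) + R (y - k)) :
    ∃ q : E → E, (∃ K : NNReal, LipschitzWith K q) ∧
      (∀ y y', R y' ≤ R y + inner ℝ (q y) (y' - y) + A * ‖y' - y‖ ^ 2) ∧
      (∀ y y', R y + inner ℝ (q y) (y' - y) - (A + c) * ‖y' - y‖ ^ 2 ≤ R y') := by
  choose q hq using hup
  have hlow : ∀ y y', R y + inner ℝ (q y) (y' - y) - (A + c) * ‖y' - y‖ ^ 2 ≤ R y' := by
    intro y y'
    have h1 := hmid y (y' - y)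
    have h2 := hq y (y - (y' - y))
    rw [add_sub_cancel] at h1
    rw [show y - (y' - y) - y = -(y' - y) by abel, inner_neg_right, norm_neg] at h2
    linarith
  refine ⟨q, ⟨⟨4 * A + 2 * (A + c), by positivity⟩, ?_⟩, hq, hlow⟩
  apply LipschitzWith.of_dist_le_mul
  intro a b
  rw [dist_eq_norm, dist_eq_norm]
  show _ ≤ (4 * A + 2 * (A + c)) * _
  set d := ‖a - b‖ with hd
  by_cases hz : q a - q b = 0
  · rw [hz, norm_zero]; positivity
  have hzp : 0 < ‖q a - q b‖ := norm_pos_iff.2 hz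
  set e : E := (d / ‖q a - q b‖) • (q a - q b) with he
  have hen : ‖e‖ = d := by
    rw [he, norm_smul, Real.norm_of_nonneg (by positivity)]; field_simp
  -- test at b - e... : R(y) with y = b - e
  -- upper at a:
  have h1 := hq a (b - e)
  have h2 := hlow b (b - e)
  have h3 := hlow b a
  have h4 := hq a b
  rw [show b - e - b = -e by abel, norm_neg, inner_neg_right, hen] at h2
  have h5 : ‖b - e - a‖ ≤ 2 * d := by
    calc ‖b - e - a‖ = ‖(b - a) - e‖ := by congr 1; abel
      _ ≤ ‖b - a‖ + ‖e‖ := norm_sub_le _ _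
      _ = 2 * d := by rw [hen, norm_sub_rev, ← hd]; ring
  have h6 : ‖b - e - a‖ ^ 2 ≤ 4 * d ^ 2 := by nlinarith [norm_nonneg (b - e - a)]
  rw [show b - e - a = (b - a) - e by abel, inner_sub_right] at h1
  rw [show b - e - a = (b - a) - e by abel] at h6
  have h7 := hlow a b
  have h8 : inner ℝ (q a - q b) e = d * ‖q a - q b‖ := by
    rw [he, inner_smul_right, real_inner_self_eq_norm_sq]; field_simp
  rw [inner_sub_left] at h8
  have h10 : ‖b - a‖ = d := by rw [norm_sub_rev]
  rw [h10] at h7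
  have h11 : A * ‖b - a - e‖ ^ 2 ≤ A * (4 * d ^ 2) := by gcongr
  have h12 : d * ‖q a - q b‖ ≤ d * ((4 * A + 2 * (A + c)) * d) := by nlinarith
  have hdp : 0 < d := by
    rw [hd, norm_pos_iff, sub_ne_zero]
    rintro rfl
    exact hz (sub_self _)
  exact le_of_mul_le_mul_left h12 hdp

lemma IsInfC.up {U R : E → ℝ} {s : ℝ} (h : IsInfC U s R) (hs : 0 < s) {x y : E}
    (hx : R y = U x + ‖x - y‖ ^ 2 / (2 * s)) (y' : E) :
    R y' ≤ R y + inner ℝ ((1 / s) • (y - x)) (y' - y) + 1 / (2 * s) * ‖y' - y‖ ^ 2 := by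
  have h1 := h.1 x y'
  have e : ‖x - y'‖ ^ 2 = ‖x - y‖ ^ 2 + 2 * inner ℝ (y - x) (y' - y) + ‖y' - y‖ ^ 2 := by
    rw [norm_sub_rev x y', norm_sub_rev x y, ← norm_add_sq_real]
    congr 2; abel
  rw [hx, real_inner_smul_left]
  rw [e] at h1
  refine h1.trans (le_of_eq ?_)
  field_simp
  ring

lemma cp_R {N : Set E} {u U R : E → ℝ} {t s : ℝ} (h : IsSupC N u t U) (h' : IsInfC U s R)
    (hs : 0 < s) (hst : s < t) :
    ∃ q : E → E, (∃ K : NNReal, LipschitzWith K q) ∧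
      (∀ y y', R y' ≤ R y + inner ℝ (q y) (y' - y) + 1 / (2 * s) * ‖y' - y‖ ^ 2) ∧
      (∀ y y', R y + inner ℝ (q y) (y' - y) - (1 / (2 * s) + 1 / (t - s)) * ‖y' - y‖ ^ 2 ≤ R y') := by
  have : 0 < t - s := by linarith
  apply cp_reg (by positivity) (by positivity)
  · intro y
    obtain ⟨x, hx⟩ := h'.2 y
    exact ⟨_, h'.up hs hx⟩
  · intro y k
    have := h'.mid h hs hst y k
    rw [div_eq_inv_mul, ← one_div] at this
    exact this

lemma IsInfC.ge {N : Set E} {u U R : E → ℝ} {r s : ℝ} (h : IsSupC N u (s + r) U) (h' : IsInfC U s R)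
    (hs : 0 < s) (hr : 0 < r) (z y : E) (hy : y ∈ N) : u y - ‖z - y‖ ^ 2 / (2 * r) ≤ R z := by
  obtain ⟨x, hx⟩ := h'.2 z
  have h1 := h.1 x y hy
  have h2 := cp_q1 hs hr (x - z) (z - y)
  rw [sub_add_sub_cancel] at h2
  rw [hx]; linarith

lemma cp_seg {s r : ℝ} (hs : 0 < s) (hr : 0 < r) (x y : E) :
    ‖x - (x + (s / (s + r)) • (y - x))‖ ^ 2 / (2 * s) +
    ‖(x + (s / (s + r)) • (y - x)) - y‖ ^ 2 / (2 * r) = ‖x - y‖ ^ 2 / (2 * (s + r)) := by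
  have e1 : x - (x + (s / (s + r)) • (y - x)) = (-(s / (s + r))) • (y - x) := by
    rw [neg_smul]; abel
  have e2 : (x + (s / (s + r)) • (y - x)) - y = (-(r / (s + r))) • (y - x) := by
    have : r / (s + r) = 1 - s / (s + r) := by field_simp; ring
    rw [this, neg_smul, sub_smul, one_smul]; abel
  rw [e1, e2, norm_smul, norm_smul, mul_pow, mul_pow, norm_sub_rev x y]
  simp only [Real.norm_eq_abs, sq_abs]
  field_simp

lemma cp_sandwich {N : Set E} {u U Ur R G : E → ℝ} {r s A : ℝ} (hr' : IsSupC N u r Ur)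
    (h : IsSupC N u (s + r) U) (h' : IsInfC U s R) (hs : 0 < s) (hr : 0 < r)
    (hG : ∀ x, Ur x ≤ G x) (hA : 2 * s * A ≤ 1) (y p : E)
    (hp : ∀ y', G y' ≤ G y + inner ℝ p (y' - y) + A * ‖y' - y‖ ^ 2) : R y ≤ G y := by
  have h1 := h'.1 (y - s • p) y
  obtain ⟨z, hz, e⟩ := h.2 (y - s • p)
  set x := y - s • p with hx
  set y' := x + (s / (s + r)) • (z - x) with hy'
  have h2 := cp_seg hs hr x z
  rw [← hy'] at h2
  have h3 := hr'.1 y' z hz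
  have h4 := (h3.trans (hG y')).trans (hp y')
  have e5 : ‖x - y'‖ ^ 2 = ‖x - y‖ ^ 2 + 2 * (s * inner ℝ p (y' - y)) + ‖y' - y‖ ^ 2 := by
    rw [norm_sub_rev x y', norm_sub_rev x y, show y' - x = (y - x) + (y' - y) by abel,
      norm_add_sq_real]
    rw [show y - x = s • p by rw [hx]; abel, real_inner_smul_left]
  have e6 : ‖x - y'‖ ^ 2 / (2 * s) = ‖x - y‖ ^ 2 / (2 * s) + inner ℝ p (y' - y)
      + ‖y' - y‖ ^ 2 / (2 * s) := by
    rw [e5]; field_simp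
  have h7 : A * ‖y' - y‖ ^ 2 ≤ ‖y' - y‖ ^ 2 / (2 * s) := by
    rw [le_div_iff₀ (by positivity)]
    nlinarith [sq_nonneg ‖y' - y‖]
  linarith

lemma cp_hasFDeriv {R : E → ℝ} {q : E → E} {A B : ℝ}
    (h1 : ∀ y y', R y' ≤ R y + inner ℝ (q y) (y' - y) + A * ‖y' - y‖ ^ 2)
    (h2 : ∀ y y', R y + inner ℝ (q y) (y' - y) - B * ‖y' - y‖ ^ 2 ≤ R y') (y : E) :
    HasFDerivAt R (innerSL ℝ (q y)) y := by
  rw [hasFDerivAt_iff_isLittleO]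
  have hO : (fun y' => R y' - R y - (innerSL ℝ (q y)) (y' - y)) =O[𝓝 y] fun y' => ‖y' - y‖ ^ 2 := by
    apply Asymptotics.IsBigO.of_bound (|A| + |B|)
    filter_upwards with y'
    have := h1 y y'
    have := h2 y y'
    have := sq_nonneg ‖y' - y‖
    rw [innerSL_apply_apply, Real.norm_eq_abs, norm_pow, norm_norm, abs_le]
    constructor <;> nlinarith [le_abs_self A, le_abs_self B, neg_abs_le A, neg_abs_le B, abs_nonneg A, abs_nonneg B]
  refine hO.trans_isLittleO ?_
  have : (fun y' => ‖y' - y‖ ^ 2) =o[𝓝 y] fun y' => ‖y' - y‖ ^ 1 := by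
    have h := (Asymptotics.isLittleO_pow_pow (𝕜 := ℝ) (m := 1) (n := 2) (by norm_num))
    have ht : Filter.Tendsto (fun y' => ‖y' - y‖) (𝓝 y) (𝓝 0) := by
      have : Continuous (fun y' => ‖y' - y‖) := by fun_prop
      simpa using this.tendsto y
    exact h.comp_tendsto ht
  simpa using this

variable [CompleteSpace E]

lemma cp_symm {R : E → ℝ} {q : E → E} {T : E →L[ℝ] E} {z : E}
    (hR : ∀ y, HasFDerivAt R (innerSL ℝ (q y)) y) (hq : HasFDerivAt q T z) (a b : E) :
    inner ℝ (T a) b = inner ℝ a (T b) := by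
  have h : HasFDerivAt (fun y => innerSL ℝ (q y)) ((innerSL ℝ).comp T) z :=
    (innerSL ℝ (E := E)).hasFDerivAt.comp z hq
  have := second_derivative_symmetric hR h a b
  simp only [ContinuousLinearMap.comp_apply, innerSL_apply_apply] at this
  rw [this, real_inner_comm]

lemma cp_second {R : E → ℝ} {q : E → E} {T : E →L[ℝ] E} {z : E}
    (hR : ∀ y, HasFDerivAt R (innerSL ℝ (q y)) y) (hq : HasFDerivAt q T z) {κ : ℝ} (hκ : 0 < κ) :
    ∀ᶠ y in 𝓝 z, |R y - R z - inner ℝ (q z) (y - z) - 1 / 2 * inner ℝ (T (y - z)) (y - z)|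
      ≤ κ * ‖y - z‖ ^ 2 := by
  have hsym := cp_symm hR hq
  have h1 : ∀ᶠ y in 𝓝 z, ‖q y - q z - T (y - z)‖ ≤ κ * ‖y - z‖ := by
    have := (hasFDerivAt_iff_isLittleO.1 hq).def hκ
    simpa using this
  obtain ⟨ρ, hρ, hb⟩ := Metric.eventually_nhds_iff.1 h1
  refine Metric.eventually_nhds_iff.2 ⟨ρ, hρ, fun y hy => ?_⟩
  set g : E → ℝ := fun y => R y - inner ℝ (q z) (y - z) - 1 / 2 * inner ℝ (T (y - z)) (y - z) with hg
  have hd : ∀ y, HasFDerivAt g (innerSL ℝ (q y - q z - T (y - z))) y := by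
    intro y
    have e1 : HasFDerivAt (fun y => y - z) (ContinuousLinearMap.id ℝ E) y := (hasFDerivAt_id y).sub_const z
    have e2 := ((innerSL ℝ (q z)).hasFDerivAt (x := y - z)).comp y e1
    have e3 := (T.hasFDerivAt (x := y - z)).comp y e1
    have e4 := (e3.inner ℝ e1).const_mul (1 / 2 : ℝ)
    have e5 := ((hR y).sub e2).sub e4
    refine e5.congr_fderiv ?_
    ext v
    simp [inner_sub_left]
    have := hsym (y - z) v
    rw [map_sub, inner_sub_left] at this
    have h2 := real_inner_comm (y - z) (T v)
    linarith
  have hm := (convex_closedBall z ‖y - z‖).norm_image_sub_le_of_norm_hasFDerivWithin_le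
    (f := g) (C := κ * ‖y - z‖) (x := z) (y := y)
    (fun x _ => (hd x).hasFDerivWithinAt) ?_ (by simp) (by simp [dist_eq_norm])
  · have : g y - g z = R y - R z - inner ℝ (q z) (y - z) - 1 / 2 * inner ℝ (T (y - z)) (y - z) := by
      simp [hg]; ring
    rw [Real.norm_eq_abs, this] at hm
    rw [pow_two, ← mul_assoc]; exact hm
  · intro x hx
    rw [innerSL_apply_norm]
    rw [mem_closedBall, dist_eq_norm] at hx
    refine (hb ?_).trans (by gcongr)
    rw [dist_eq_norm] at hy ⊢
    linarith
end SC

section SD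
variable {E : Type*} [NormedAddCommGroup E] [InnerProductSpace ℝ E] [FiniteDimensional ℝ E]

section meas
variable [MeasurableSpace E] [BorelSpace E] (μ : Measure E) [μ.IsAddHaarMeasure]

lemma cp_null {f : E → E} {K : NNReal} (hf : LipschitzWith K f) {s : Set E} (hs : μ s = 0) :
    μ (f '' s) = 0 := by
  have h1 : (μH[(Module.finrank ℝ E : ℝ)] : Measure E) ≪ μ := by
    rw [Measure.isAddLeftInvariant_eq_smul (μH[(Module.finrank ℝ E : ℝ)] : Measure E) μ]
    exact Measure.smul_absolutelyContinuous
  have h2 : μ ≪ (μH[(Module.finrank ℝ E : ℝ)] : Measure E) := by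
    rw [Measure.isAddLeftInvariant_eq_smul μ (μH[(Module.finrank ℝ E : ℝ)] : Measure E)]
    exact Measure.smul_absolutelyContinuous
  apply h2
  have := hf.hausdorffMeasure_image_le (d := (Module.finrank ℝ E : ℝ)) (by positivity) s
  rw [h1 hs, mul_zero] at this
  exact le_antisymm this (zero_le)

lemma cp_img {f : E → E} {K : NNReal} (hf : LipschitzWith K f) {s : Set E} {C : ℝ}
    (h : ∀ x ∈ s, DifferentiableAt ℝ f x → |(fderiv ℝ f x).det| ≤ C) :
    μ (f '' s) ≤ ENNReal.ofReal C * μ s := by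
  set A : Set E := toMeasurable μ s ∩ ({x | DifferentiableAt ℝ f x} ∩
    {x | |(fderiv ℝ f x).det| ≤ C}) with hA
  have hm : MeasurableSet A := by
    refine (measurableSet_toMeasurable μ s).inter ((measurableSet_of_differentiableAt ℝ f).inter ?_)
    refine measurableSet_le ?_ measurable_const
    have h1 : Measurable fun x => (fderiv ℝ f x).det :=
      (ContinuousLinearMap.continuous_det).measurable.comp (measurable_fderiv ℝ f)
    exact (continuous_abs.measurable).comp h1
  have hsub : s ⊆ A ∪ {x | ¬ DifferentiableAt ℝ f x} := by
    intro x hx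
    by_cases hd : DifferentiableAt ℝ f x
    · exact Or.inl ⟨subset_toMeasurable μ s hx, hd, h x hx hd⟩
    · exact Or.inr hd
  have hnull : μ {x | ¬ DifferentiableAt ℝ f x} = 0 := by
    have := hf.ae_differentiableAt (μ := μ)
    exact this
  have h1 : μ (f '' A) ≤ ∫⁻ x in A, ENNReal.ofReal |(fderiv ℝ f x).det| ∂μ :=
    addHaar_image_le_lintegral_abs_det_fderiv μ hm
      (fun x hx => (hx.2.1.hasFDerivAt).hasFDerivWithinAt)
  have h2 : ∫⁻ x in A, ENNReal.ofReal |(fderiv ℝ f x).det| ∂μ ≤ ENNReal.ofReal C * μ s := by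
    calc _ ≤ ∫⁻ x in A, ENNReal.ofReal C ∂μ := by
          apply setLIntegral_mono measurable_const
          intro x hx
          exact ENNReal.ofReal_le_ofReal hx.2.2
      _ = ENNReal.ofReal C * μ A := by simp
      _ ≤ _ := by
          refine mul_le_mul' le_rfl ?_
          calc μ A ≤ μ (toMeasurable μ s) := measure_mono inter_subset_left
            _ = μ s := measure_toMeasurable s
  calc μ (f '' s) ≤ μ (f '' A ∪ f '' {x | ¬ DifferentiableAt ℝ f x}) := by
        rw [← image_union]; exact measure_mono (image_mono hsub)
    _ ≤ μ (f '' A) + μ (f '' {x | ¬ DifferentiableAt ℝ f x}) := measure_union_le _ _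
    _ = μ (f '' A) := by rw [cp_null μ hf hnull, add_zero]
    _ ≤ _ := h1.trans h2
end meas

def CSym (T : E →L[ℝ] E) : Prop := ∀ a b, inner ℝ (T a) b = inner ℝ a (T b)
def CTr (T : E →L[ℝ] E) : ℝ := LinearMap.trace ℝ E (T : E →ₗ[ℝ] E)

lemma CTr_add (S T : E →L[ℝ] E) : CTr (S + T) = CTr S + CTr T := by simp [CTr]
lemma CTr_smul (c : ℝ) (T : E →L[ℝ] E) : CTr (c • T) = c * CTr T := by simp [CTr]
lemma CTr_neg (T : E →L[ℝ] E) : CTr (-T) = - CTr T := by simp [CTr]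
lemma CTr_sub (S T : E →L[ℝ] E) : CTr (S - T) = CTr S - CTr T := by simp [CTr]
lemma CTr_id : CTr (ContinuousLinearMap.id ℝ E) = Module.finrank ℝ E := by
  simp [CTr]

lemma CSym.add {S T : E →L[ℝ] E} (hS : CSym S) (hT : CSym T) : CSym (S + T) := by
  intro a b; simp [inner_add_left, inner_add_right, hS a b, hT a b]
lemma CSym.smul {S : E →L[ℝ] E} (hS : CSym S) (c : ℝ) : CSym (c • S) := by
  intro a b; simp [inner_smul_left, inner_smul_right, hS a b]
lemma CSym.neg {S : E →L[ℝ] E} (hS : CSym S) : CSym (-S) := by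
  intro a b; simp [hS a b]
lemma CSym.sub {S T : E →L[ℝ] E} (hS : CSym S) (hT : CSym T) : CSym (S - T) := by
  intro a b; simp [inner_sub_left, inner_sub_right, hS a b, hT a b]
lemma CSym.id : CSym (ContinuousLinearMap.id ℝ E) := by
  intro a b; simp
lemma CSym.zero : CSym (0 : E →L[ℝ] E) := by
  intro a b; simp

lemma cp_det {P : E →L[ℝ] E} (hP : CSym P) (h0 : ∀ h, 0 ≤ inner ℝ (P h) h) :
    0 ≤ CTr P ∧ |P.det| ≤ CTr P ^ (Module.finrank ℝ E) := by
  have hs : (P : E →ₗ[ℝ] E).IsSymmetric := fun a b => hP a b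
  have hp : (P : E →ₗ[ℝ] E).IsPositive := (LinearMap.isPositive_iff _).2 ⟨hs, h0⟩
  have e0 := hp.nonneg_eigenvalues rfl
  have ht : CTr P = ∑ i, hs.eigenvalues rfl i := by
    have := hs.trace_eq_sum_eigenvalues rfl
    simpa [CTr] using this
  have hd : P.det = ∏ i, hs.eigenvalues rfl i := by
    have := hs.det_eq_prod_eigenvalues rfl
    simpa [ContinuousLinearMap.det] using this
  have hnn : 0 ≤ CTr P := by rw [ht]; exact Finset.sum_nonneg fun i _ => e0 i
  refine ⟨hnn, ?_⟩
  rw [hd, abs_of_nonneg (Finset.prod_nonneg fun i _ => e0 i)]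
  calc _ ≤ ∏ i : Fin (Module.finrank ℝ E), CTr P := by
        apply Finset.prod_le_prod (fun i _ => e0 i)
        intro i _
        rw [ht]
        exact Finset.single_le_sum (f := fun i => hs.eigenvalues rfl i) (fun i _ => e0 i) (Finset.mem_univ i)
    _ = _ := by simp

def EllOp (lam Lam : ℝ) (Φ : (E →L[ℝ] E) → ℝ) : Prop :=
  Continuous Φ ∧ Φ 0 = 0 ∧ ∀ T P : E →L[ℝ] E, CSym T → CSym P → (∀ h, 0 ≤ inner ℝ (P h) h) →
    lam * CTr P ≤ Φ T - Φ (T + P) ∧ Φ T - Φ (T + P) ≤ Lam * CTr P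

lemma EllOp.dual {lam Lam : ℝ} {Φ : (E →L[ℝ] E) → ℝ} (h : EllOp lam Lam Φ) :
    EllOp lam Lam (fun T => - Φ (-T)) := by
  refine ⟨by have := h.1; fun_prop, by simp [h.2.1], fun T P hT hP h0 => ?_⟩
  have := h.2.2 (-(T+P)) P (hT.add hP).neg hP h0
  have e : -(T+P)+P = -T := by abel
  rw [e] at this
  constructor <;> linarith [this.1, this.2]

def CpJet (Ω : Set E) (u : E → ℝ) (Φ : (E →L[ℝ] E) → ℝ) (ε : ℝ) (H : E → E → ℝ) : Prop :=
  ∀ y ∈ Ω, ∀ p : E, ∀ T : E →L[ℝ] E, CSym T →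
    (∀ᶠ y' in 𝓝 y, u y' ≤ u y + inner ℝ p (y' - y) + 1/2 * inner ℝ (T (y' - y)) (y' - y)) →
    ε * u y + Φ T ≤ H y p

lemma cp_touch {Ω : Set E} {u : E → ℝ} {lam Lam : ℝ} {Φ : (E →L[ℝ] E) → ℝ} {ε : ℝ} {H : E → E → ℝ}
    (hΩ : IsOpen Ω) (hΦ : EllOp lam Lam Φ)
    (hJ : CpJet Ω u Φ ε H) {R : E → ℝ} {q : E → E} {T : E →L[ℝ] E} {y z : E} (hy : y ∈ Ω)
    (hR : ∀ y, HasFDerivAt R (innerSL ℝ (q y)) y) (hq : HasFDerivAt q T z)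
    (ht : ∀ y' ∈ Ω, u y' ≤ u y + R (z + (y' - y)) - R z) :
    CSym T ∧ ε * u y + Φ T ≤ H y (q z) := by
  have hT : CSym T := fun a b => cp_symm hR hq a b
  refine ⟨hT, ?_⟩
  have key : ∀ κ : ℝ, 0 < κ → ε * u y + Φ (T + (2*κ) • ContinuousLinearMap.id ℝ E) ≤ H y (q z) := by
    intro κ hκ
    apply hJ y hy (q z) _ (hT.add (CSym.id.smul _))
    have h2 := cp_second hR hq hκ
    have hc : Filter.Tendsto (fun y' => z + (y' - y)) (𝓝 y) (𝓝 z) := by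
      have : Continuous fun y' : E => z + (y' - y) := by fun_prop
      have := this.tendsto y
      simpa using this
    filter_upwards [hc.eventually h2, hΩ.mem_nhds hy] with y' h3 hy'
    have h4 := ht y' hy'
    have e1 : z + (y' - y) - z = y' - y := by abel
    rw [e1] at h3
    have h5 := (abs_le.1 h3).2
    simp only [add_apply, smul_apply,
      ContinuousLinearMap.id_apply, inner_add_left, inner_smul_left, real_inner_self_eq_norm_sq]
    simp only [conj_trivial]
    linarith
  have hlim : Filter.Tendsto (fun κ : ℝ => ε * u y + Φ (T + (2*κ) • ContinuousLinearMap.id ℝ E))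
      (𝓝[>] 0) (𝓝 (ε * u y + Φ T)) := by
    have hc : Continuous (fun κ : ℝ => ε * u y + Φ (T + (2*κ) • ContinuousLinearMap.id ℝ E)) := by
      have := hΦ.1
      fun_prop
    have := hc.tendsto 0
    simp only [mul_zero, zero_smul, add_zero] at this
    exact this.mono_left nhdsWithin_le_nhds
  apply le_of_tendsto hlim
  filter_upwards [self_mem_nhdsWithin] with κ hκ
  exact key κ hκ
end SD

section SE
variable {E : Type*} [NormedAddCommGroup E] [InnerProductSpace ℝ E] [FiniteDimensional ℝ E]

lemma cp_lin {v : E} {C : ℝ} (h : ∀ x : E, inner ℝ v x ≤ C * ‖x‖^2) : v = 0 := by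
  by_contra hv
  have hp : 0 < ‖v‖^2 := by positivity
  set τ : ℝ := 1/(2*(|C|+1)) with hτ
  have hτ0 : 0 < τ := by positivity
  have h1 := h (τ • v)
  rw [inner_smul_right, norm_smul, real_inner_self_eq_norm_sq, Real.norm_of_nonneg hτ0.le] at h1
  have h2 : C * τ ≤ 1/2 := by
    rw [hτ, mul_one_div, div_le_div_iff₀ (by positivity) (by norm_num)]
    nlinarith [le_abs_self C]
  have h3 : C * (τ * ‖v‖)^2 = (C*τ) * (τ * ‖v‖^2) := by ring
  rw [h3] at h1
  have : 0 < τ * ‖v‖^2 := by positivity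
  nlinarith

lemma cp_Tle {R : E → ℝ} {q : E → E} {T : E →L[ℝ] E} {z : E} {C : ℝ}
    (hR : ∀ y, HasFDerivAt R (innerSL ℝ (q y)) y) (hq : HasFDerivAt q T z)
    (h : ∀ y', R y' ≤ R z + inner ℝ (q z) (y' - z) + C * ‖y' - z‖^2) (x : E) :
    inner ℝ (T x) x ≤ 2 * C * ‖x‖^2 := by
  have key : ∀ κ : ℝ, 0 < κ → inner ℝ (T x) x ≤ 2 * C * ‖x‖^2 + κ * (2 * ‖x‖^2) := by
    intro κ hκ
    have h2 := cp_second hR hq hκ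
    have hc : Filter.Tendsto (fun τ : ℝ => z + τ • x) (𝓝[>] 0) (𝓝 z) := by
      have : Continuous fun τ : ℝ => z + τ • x := by fun_prop
      have := this.tendsto 0
      simp only [zero_smul, add_zero] at this
      exact this.mono_left nhdsWithin_le_nhds
    obtain ⟨τ, h3, h4⟩ := ((hc.eventually h2).and self_mem_nhdsWithin).exists
    have h4 : 0 < τ := h4
    have h5 := (abs_le.1 h3).1
    have h6 := h (z + τ • x)
    simp only [add_sub_cancel_left, map_smul, inner_smul_left, inner_smul_right, norm_smul,
      conj_trivial, Real.norm_of_nonneg h4.le] at h5 h6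
    have h7 : τ^2 * inner ℝ (T x) x ≤ τ^2 * (2 * C * ‖x‖^2 + κ * (2 * ‖x‖^2)) := by nlinarith
    exact le_of_mul_le_mul_left h7 (by positivity)
  by_contra hcon
  push Not at hcon
  set d := inner ℝ (T x) x - 2 * C * ‖x‖^2 with hd
  have hd0 : 0 < d := by linarith
  have h8 := key (d / (4*(‖x‖^2+1))) (by positivity)
  have h9 : d / (4*(‖x‖^2+1)) * (2 * ‖x‖^2) ≤ d/2 := by
    rw [div_mul_eq_mul_div, div_le_div_iff₀ (by positivity) (by norm_num)]
    nlinarith [sq_nonneg ‖x‖]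
  linarith

variable [MeasurableSpace E] [BorelSpace E] (μ : Measure E) [μ.IsAddHaarMeasure]

lemma cp_S1 {Ω N O : Set E} {u U : E → ℝ} {lam Lam : ℝ} {Φ : (E →L[ℝ] E) → ℝ} {ε δ η m H0 : ℝ}
    {H : E → E → ℝ} (hΩ : IsOpen Ω) (hΩN : Ω ⊆ N) (hlam : 0 < lam) (hΦ : EllOp lam Lam Φ)
    (hJ : CpJet Ω u Φ ε H) (hε : 0 ≤ ε) (hm : 0 ≤ m) (hH0 : 0 ≤ H0) (hH : ∀ y ∈ Ω, ∀ p, |H y p| ≤ H0)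
    (hδ : 0 < δ) (hδ1 : δ ≤ 1) (hη : 0 < η) (h : IsSupC N u (δ+η) U) :
    μ {x | ∃ y ∈ Ω, U x = u y - ‖x-y‖^2/(2*(δ+η)) ∧ -m < u y ∧ x + (δ/(δ+η))•(y-x) ∈ O} ≤
      ENNReal.ofReal (((H0 + ε*m + Lam * Module.finrank ℝ E)/lam)^(Module.finrank ℝ E)) * μ O := by
  obtain ⟨R, h'⟩ := exists_infC h hδ (by linarith : δ < δ + η)
  obtain ⟨q, ⟨K, hK⟩, hup, hlow⟩ := cp_R h h' hδ (by linarith : δ < δ + η)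
  have hR : ∀ y, HasFDerivAt R (innerSL ℝ (q y)) y := fun y => cp_hasFDeriv hup hlow y
  set Z : Set E := {z ∈ O | ∃ y ∈ Ω, ∃ x, U x = u y - ‖x-y‖^2/(2*(δ+η)) ∧ -m < u y ∧
    x + (δ/(δ+η))•(y-x) = z} with hZ
  set g : E → E := fun z => z - δ • q z with hg
  have hgL : ∃ K', LipschitzWith K' g := by
    refine ⟨_, LipschitzWith.id.sub ((lipschitzWith_smul δ).comp hK)⟩
  obtain ⟨K', hK'⟩ := hgL
  have basic : ∀ x y, y ∈ Ω → U x = u y - ‖x-y‖^2/(2*(δ+η)) → ∀ z, x + (δ/(δ+η))•(y-x) = z →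
      R z = U x + ‖x-z‖^2/(2*δ) ∧ R z = u y - ‖z-y‖^2/(2*η) := by
    intro x y hy hU z hz
    have e1 := cp_seg hδ hη x y
    rw [hz] at e1
    have e2 := h'.1 x z
    have e3 := IsInfC.ge h h' hδ hη z y (hΩN hy)
    constructor <;> linarith
  have hqz : ∀ x y, y ∈ Ω → U x = u y - ‖x-y‖^2/(2*(δ+η)) → ∀ z, x + (δ/(δ+η))•(y-x) = z →
      g z = x := by
    intro x y hy hU z hz
    have e1 := (basic x y hy hU z hz).1
    have e2 := h'.up hδ e1
    have e3 : q z - (1/δ)•(z-x) = 0 := by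
      apply cp_lin (C := 1/(2*δ) + (1/(2*δ)+1/η))
      intro w
      have a1 := e2 (z+w)
      have a2 := hlow z (z+w)
      simp only [add_sub_cancel_left] at a1 a2
      rw [inner_sub_left]
      linarith
    have e4 : q z = (1/δ)•(z-x) := sub_eq_zero.1 e3
    simp only [hg, e4, smul_smul, mul_one_div_cancel hδ.ne', one_smul]
    abel
  have hsub : {x | ∃ y ∈ Ω, U x = u y - ‖x-y‖^2/(2*(δ+η)) ∧ -m < u y ∧ x + (δ/(δ+η))•(y-x) ∈ O}
      ⊆ g '' Z := by
    rintro x ⟨y, hy, hU, hmu, hO⟩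
    exact ⟨_, ⟨hO, y, hy, x, hU, hmu, rfl⟩, hqz x y hy hU _ rfl⟩
  refine (measure_mono hsub).trans ?_
  refine (cp_img μ hK' (C := ((H0 + ε*m + Lam * Module.finrank ℝ E)/lam)^(Module.finrank ℝ E)) ?_).trans ?_
  swap
  · exact mul_le_mul' le_rfl (measure_mono fun z hz => hz.1)
  rintro z ⟨hzO, y, hy, x, hU, hmu, hz⟩ hd
  obtain ⟨e1, e2⟩ := basic x y hy hU z hz
  have hqd : DifferentiableAt ℝ q z := by
    have e : q = fun z => (1/δ) • (z - g z) := by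
      funext w
      simp [hg, smul_smul, hδ.ne']
    rw [e]
    exact (differentiableAt_id.sub hd).const_smul _
  set T := fderiv ℝ q z with hTdef
  have hT : HasFDerivAt q T z := hqd.hasFDerivAt
  obtain ⟨hTs, hTJ⟩ := cp_touch hΩ hΦ hJ hy hR hT (by
    intro y' hy'
    have := IsInfC.ge h h' hδ hη (z + (y' - y)) y' (hΩN hy')
    have e5 : z + (y' - y) - y' = z - y := by abel
    rw [e5] at this
    linarith)
  have hle := fun x => cp_Tle hR hT (hup z) x
  set P := (1/δ) • ContinuousLinearMap.id ℝ E - T with hPdef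
  have hPs : CSym P := (CSym.id.smul _).sub hTs
  have hP0 : ∀ x, 0 ≤ inner ℝ (P x) x := by
    intro w
    have := hle w
    simp only [hPdef, sub_apply, smul_apply,
      ContinuousLinearMap.id_apply, inner_sub_left, inner_smul_left, real_inner_self_eq_norm_sq,
      conj_trivial]
    have e : 2 * (1/(2*δ)) = 1/δ := by field_simp
    rw [e] at this
    linarith
  have hE1 := (hΦ.2.2 T P hTs hPs hP0).1
  have eTP : T + P = (1/δ) • ContinuousLinearMap.id ℝ E := by rw [hPdef]; abel
  have hE2 := (hΦ.2.2 0 ((1/δ) • ContinuousLinearMap.id ℝ E) CSym.zero (CSym.id.smul _) (by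
    intro w
    simp only [smul_apply, ContinuousLinearMap.id_apply, inner_smul_left,
      real_inner_self_eq_norm_sq, conj_trivial]
    positivity)).2
  rw [zero_add, hΦ.2.1, CTr_smul, CTr_id] at hE2
  rw [eTP] at hE1
  have hHH := (abs_le.1 (hH y hy (q z))).2
  have hlt : lam * CTr P ≤ H0 + ε * m + Lam * (1/δ * Module.finrank ℝ E) := by
    nlinarith
  have hfd : fderiv ℝ g z = δ • P := by
    have : HasFDerivAt g (ContinuousLinearMap.id ℝ E - δ • T) z :=
      (hasFDerivAt_id z).sub (hT.const_smul δ)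
    rw [this.fderiv, hPdef, smul_sub, smul_smul, mul_one_div_cancel hδ.ne', one_smul]
  rw [hfd]
  have hdet := cp_det (hPs.smul δ) (by
    intro w
    simp only [smul_apply, inner_smul_left, conj_trivial]
    exact mul_nonneg hδ.le (hP0 w))
  refine hdet.2.trans (pow_le_pow_left₀ hdet.1 ?_ _)
  rw [CTr_smul, le_div_iff₀ hlam]
  have e6 : δ * (Lam * (1/δ * Module.finrank ℝ E)) = Lam * Module.finrank ℝ E := by
    field_simp
  have e7 : δ * (lam * CTr P) ≤ δ * (H0 + ε * m + Lam * (1/δ * Module.finrank ℝ E)) :=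
    mul_le_mul_of_nonneg_left hlt hδ.le
  have e8 : δ * (H0 + ε * m) ≤ H0 + ε * m := by
    have : 0 ≤ H0 + ε * m := by positivity
    nlinarith
  nlinarith
end SE

section SF
variable {E : Type*} [NormedAddCommGroup E] [InnerProductSpace ℝ E] [FiniteDimensional ℝ E]

lemma cp_eta : Filter.Tendsto (fun k : ℕ => (1:ℝ)/(k+1)) Filter.atTop (𝓝 0) :=
  tendsto_one_div_add_atTop_nhds_zero_nat

lemma cp_contact {N : Set E} {u : E → ℝ} (hN : IsCompact N) (hu : UpperSemicontinuousOn u N)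
    {δ : ℝ} (hδ : 0 < δ) {x y : E} (hy : y ∈ N)
    (hmax : ∀ y' ∈ N, y' ≠ y → u y' - ‖x-y'‖^2/(2*δ) < u y - ‖x-y‖^2/(2*δ))
    {Y : ℕ → E} (hYN : ∀ k, Y k ∈ N)
    (hY : ∀ k : ℕ, u y - ‖x-y‖^2/(2*(δ+1/(k+1))) ≤ u (Y k) - ‖x-Y k‖^2/(2*(δ+1/(k+1)))) :
    Filter.Tendsto Y Filter.atTop (𝓝 y) := by
  rw [Metric.tendsto_nhds]
  intro r hr
  set N' := N \ ball y r with hN'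
  have hN'c : IsCompact N' := hN.diff isOpen_ball
  by_cases hne : N'.Nonempty
  swap
  · refine Filter.Eventually.of_forall fun k => ?_
    by_contra hc
    exact hne ⟨Y k, hYN k, by simpa [mem_ball] using hc⟩
  obtain ⟨U', hU'⟩ := exists_supC hN'c hne (hu.mono sdiff_subset) δ
  obtain ⟨ys, hys, hUs⟩ := hU'.2 x
  have hgap := hmax ys hys.1 (by
    rintro rfl
    exact hys.2 (mem_ball_self hr))
  obtain ⟨D, hD⟩ := hN.isBounded.exists_norm_le
  have hc : Filter.Tendsto (fun k : ℕ => (‖x‖+D)^2 * (1/(2*δ) - 1/(2*(δ+1/((k:ℝ)+1))))) Filter.atTop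
      (𝓝 ((‖x‖+D)^2 * (1/(2*δ) - 1/(2*(δ+0))))) := by
    refine Filter.Tendsto.const_mul _ (Filter.Tendsto.const_sub _ ?_)
    refine Filter.Tendsto.div tendsto_const_nhds ((cp_eta.const_add δ).const_mul 2) (by simpa using hδ.ne')
  rw [add_zero, sub_self, mul_zero] at hc
  have hev := hc.eventually (gt_mem_nhds (sub_pos.2 hgap))
  filter_upwards [hev] with k hk
  by_contra hcon
  have hmem : Y k ∈ N' := ⟨hYN k, by simpa [mem_ball] using hcon⟩
  have h1 := hU'.1 x (Y k) hmem
  have h2 := hY k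
  have hk0 : (0:ℝ) < 1/((k:ℝ)+1) := by positivity
  set e := 1/((k:ℝ)+1) with he
  have h3 : 1/(2*(δ+e)) ≤ 1/(2*δ) := by
    apply one_div_le_one_div_of_le <;> linarith
  have h4 : ‖x - Y k‖^2 ≤ (‖x‖+D)^2 := by
    apply pow_le_pow_left₀ (norm_nonneg _)
    exact (norm_sub_le _ _).trans (by linarith [hD _ (hYN k)])
  have h5 : ‖x-Y k‖^2 * (1/(2*δ) - 1/(2*(δ+e))) ≤ (‖x‖+D)^2 * (1/(2*δ) - 1/(2*(δ+e))) :=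
    mul_le_mul_of_nonneg_right h4 (by linarith)
  have h6 : 0 ≤ ‖x-y‖^2 * (1/(2*δ) - 1/(2*(δ+e))) := mul_nonneg (sq_nonneg _) (by linarith)
  simp only [div_eq_mul_one_div (‖x-y‖^2), div_eq_mul_one_div (‖x-Y k‖^2),
    div_eq_mul_one_div (‖x-ys‖^2)] at *
  linarith

variable [MeasurableSpace E] [BorelSpace E] (μ : Measure E) [μ.IsAddHaarMeasure]

lemma cp_S2 {Ω N O : Set E} {u : E → ℝ} {lam Lam : ℝ} {Φ : (E →L[ℝ] E) → ℝ} {ε δ m H0 : ℝ}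
    {H : E → E → ℝ} (hΩ : IsOpen Ω) (hΩN : Ω ⊆ N) (hN : IsCompact N) (hne : N.Nonempty)
    (hu : UpperSemicontinuousOn u N) (hO : IsOpen O) (hOΩ : O ⊆ Ω) (hlam : 0 < lam)
    (hΦ : EllOp lam Lam Φ)
    (hJ : CpJet Ω u Φ ε H) (hε : 0 ≤ ε) (hm : 0 ≤ m) (hH0 : 0 ≤ H0) (hH : ∀ y ∈ Ω, ∀ p, |H y p| ≤ H0)
    (hδ : 0 < δ) (hδ1 : δ ≤ 1) :
    μ {x | ∃ y ∈ O, -m < u y ∧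
        ∀ y' ∈ N, y' ≠ y → u y' - ‖x-y'‖^2/(2*δ) < u y - ‖x-y‖^2/(2*δ)} ≤
      ENNReal.ofReal (((H0 + ε*m + Lam * Module.finrank ℝ E)/lam)^(Module.finrank ℝ E)) * μ O := by
  choose U hU using fun k : ℕ => exists_supC hN hne hu (δ + 1/((k:ℝ)+1))
  set B : ℕ → Set E := fun k => {x | ∃ y ∈ Ω, U k x = u y - ‖x-y‖^2/(2*(δ+1/((k:ℝ)+1))) ∧ -m < u y ∧
    x + (δ/(δ+1/((k:ℝ)+1)))•(y-x) ∈ O} with hB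
  have hBk : ∀ k, μ (B k) ≤ ENNReal.ofReal (((H0 + ε*m + Lam * Module.finrank ℝ E)/lam)^(Module.finrank ℝ E)) * μ O :=
    fun k => cp_S1 μ hΩ hΩN hlam hΦ hJ hε hm hH0 hH hδ hδ1 (by positivity) (hU k)
  have hsub : {x | ∃ y ∈ O, -m < u y ∧
        ∀ y' ∈ N, y' ≠ y → u y' - ‖x-y'‖^2/(2*δ) < u y - ‖x-y‖^2/(2*δ)} ⊆ ⋃ k, ⋂ j ≥ k, B j := by
    rintro x ⟨y, hyO, hmu, hmax⟩
    have hyN : y ∈ N := hΩN (hOΩ hyO)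
    choose Y hYN hY using fun k => (hU k).2 x
    have hYle : ∀ k : ℕ, u y - ‖x-y‖^2/(2*(δ+1/((k:ℝ)+1))) ≤ u (Y k) - ‖x-Y k‖^2/(2*(δ+1/((k:ℝ)+1))) := by
      intro k
      rw [← hY k]
      exact (hU k).1 x y hyN
    have hYt := cp_contact hN hu hδ hyN hmax hYN hYle
    have hd1 : Filter.Tendsto (fun k : ℕ => δ + 1/((k:ℝ)+1)) Filter.atTop (𝓝 (δ + 0)) :=
      cp_eta.const_add δ
    rw [add_zero] at hd1
    have e1 : ∀ᶠ k in Filter.atTop, Y k ∈ O := hYt.eventually (hO.mem_nhds hyO)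
    have e2 : ∀ᶠ k : ℕ in Filter.atTop, x + (δ/(δ+1/((k:ℝ)+1)))•(Y k-x) ∈ O := by
      have : Filter.Tendsto (fun k : ℕ => x + (δ/(δ+1/((k:ℝ)+1)))•(Y k-x)) Filter.atTop
          (𝓝 (x + (δ/δ)•(y-x))) := by
        refine Filter.Tendsto.const_add _ (Filter.Tendsto.smul ?_ (hYt.sub_const x))
        exact tendsto_const_nhds.div hd1 hδ.ne'
      rw [div_self hδ.ne', one_smul, add_sub_cancel] at this
      exact this.eventually (hO.mem_nhds hyO)
    have e3 : ∀ᶠ k : ℕ in Filter.atTop, -m < u (Y k) := by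
      have : Filter.Tendsto (fun k : ℕ => u y - ‖x-y‖^2/(2*(δ+1/((k:ℝ)+1))) +
          ‖x-Y k‖^2/(2*(δ+1/((k:ℝ)+1)))) Filter.atTop
          (𝓝 (u y - ‖x-y‖^2/(2*δ) + ‖x-y‖^2/(2*δ))) := by
        refine Filter.Tendsto.add (Filter.Tendsto.const_sub _ ?_) ?_
        · exact tendsto_const_nhds.div (hd1.const_mul 2) (by positivity)
        · exact (((hYt.const_sub x).norm).pow 2).div (hd1.const_mul 2) (by positivity)
      rw [sub_add_cancel] at this
      filter_upwards [this.eventually (lt_mem_nhds hmu)] with k hk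
      linarith [hYle k]
    obtain ⟨k, hk⟩ := Filter.eventually_atTop.1 (e1.and (e2.and e3))
    refine mem_iUnion.2 ⟨k, mem_iInter₂.2 fun j hj => ?_⟩
    obtain ⟨h1, h2, h3⟩ := hk j hj
    exact ⟨Y j, hOΩ h1, hY j, h3, h2⟩
  refine (measure_mono hsub).trans ?_
  have hmono : Monotone fun k => ⋂ j ≥ k, B j := by
    intro k l hkl x hx
    simp only [mem_iInter] at hx ⊢
    exact fun j hj => hx j (le_trans hkl hj)
  rw [hmono.measure_iUnion]
  refine iSup_le fun k => ?_
  refine (measure_mono ?_).trans (hBk k)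
  exact iInter₂_subset k le_rfl
end SF

section SG
variable {E : Type*} [NormedAddCommGroup E] [InnerProductSpace ℝ E] [FiniteDimensional ℝ E]

def CpReg (N : Set E) (u : E → ℝ) (t : ℝ) (R : E → ℝ) (q : E → E) : Prop :=
  (∃ K, LipschitzWith K q) ∧ (∃ C, (∀ y y', R y' ≤ R y + inner ℝ (q y) (y'-y) + C*‖y'-y‖^2) ∧
    ∀ y y', R y + inner ℝ (q y) (y'-y) - C*‖y'-y‖^2 ≤ R y') ∧
    ∀ z, ∀ y ∈ N, u y - ‖z-y‖^2/(2*t) ≤ R z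

lemma cp_parab (t : ℝ) (y y' c : E) : ‖y'-c‖^2/(2*t) = ‖y-c‖^2/(2*t) +
    inner ℝ ((1/t)•(y-c)) (y'-y) + 1/(2*t)*‖y'-y‖^2 := by
  have e : y' - c = (y - c) + (y' - y) := by abel
  rw [e, norm_add_sq_real, inner_smul_left]
  simp only [conj_trivial]
  ring

lemma CpReg.hasF {N : Set E} {u : E → ℝ} {t : ℝ} {R : E → ℝ} {q : E → E} (h : CpReg N u t R q) :
    ∀ y, HasFDerivAt R (innerSL ℝ (q y)) y := by
  obtain ⟨_, ⟨C, h1, h2⟩, _⟩ := h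
  exact fun y => cp_hasFDeriv h1 h2 y

lemma CpReg.contact {N : Set E} {u : E → ℝ} {t : ℝ} {R : E → ℝ} {q : E → E} (h : CpReg N u t R q)
    (ht : 0 < t) {x y : E} (hy : y ∈ N) (hx : R x = u y - ‖x-y‖^2/(2*t)) : y = x + t • q x := by
  obtain ⟨_, ⟨C, h1, h2⟩, h3⟩ := h
  have e : -((1/t)•(x-y)) - q x = 0 := by
    apply cp_lin (C := C + 1/(2*t))
    intro w
    have a1 := h1 x (x+w)
    have a2 := h3 (x+w) y hy
    rw [cp_parab t x (x+w) y] at a2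
    simp only [add_sub_cancel_left] at a1 a2
    rw [inner_sub_left, inner_neg_left]
    linarith
  have e2 : q x = -((1/t)•(x-y)) := (sub_eq_zero.1 e).symm
  rw [e2, smul_neg, smul_smul, mul_one_div_cancel ht.ne', one_smul]
  abel

lemma CpReg.strict {N : Set E} {u : E → ℝ} {t : ℝ} {R : E → ℝ} {q : E → E} (h : CpReg N u t R q)
    (ht : 0 < t) {x y : E} (hy : y ∈ N) (hx : R x = u y - ‖x-y‖^2/(2*t)) :
    ∀ y' ∈ N, y' ≠ y → u y' - ‖x-y'‖^2/(2*t) < u y - ‖x-y‖^2/(2*t) := by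
  intro y' hy' hne
  have h1 := h.2.2 x y' hy'
  rw [hx] at h1
  refine lt_of_le_of_ne h1 fun he => hne ?_
  rw [h.contact ht hy hx, h.contact ht hy' (hx.trans he.symm)]

lemma CpReg.touch {N : Set E} {u : E → ℝ} {t : ℝ} {R : E → ℝ} {q : E → E} (h : CpReg N u t R q)
    {x y : E} (hx : R x = u y - ‖x-y‖^2/(2*t)) :
    ∀ y' ∈ N, u y' ≤ u y + R (x + (y' - y)) - R x := by
  intro y' hy'
  have := h.2.2 (x + (y' - y)) y' hy'
  have e5 : x + (y' - y) - y' = x - y := by abel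
  rw [e5] at this
  linarith

lemma cp_pair {N : Set E} (hN : IsCompact N) (hne : N.Nonempty) {u1 u2 U1 U2 : E → ℝ}
    (hu1 : UpperSemicontinuousOn u1 N) (hu2 : UpperSemicontinuousOn u2 N) {t : ℝ} (ht : 0 < t)
    (h1 : IsSupC N u1 t U1) (h2 : IsSupC N u2 t U2) :
    ∃ R1 R2 q1 q2, CpReg N u1 t R1 q1 ∧ CpReg N u2 t R2 q2 ∧
      ∀ ξ xb, (∀ x, U1 x + U2 x + inner ℝ ξ x ≤ U1 xb + U2 xb + inner ℝ ξ xb) →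
        R1 xb = U1 xb ∧ R2 xb = U2 xb ∧ 
        ∀ x, R1 x + R2 x + inner ℝ ξ x ≤ R1 xb + R2 xb + inner ℝ ξ xb := by
  obtain ⟨V1, hV1⟩ := exists_supC hN hne hu1 (t+t)
  obtain ⟨R1, hR1⟩ := exists_infC hV1 ht (by linarith : t < t+t)
  obtain ⟨q1, hq1L, hup1, hlow1⟩ := cp_R hV1 hR1 ht (by linarith : t < t+t)
  have hs2 : 0 < t/3 := by positivity
  obtain ⟨V2, hV2⟩ := exists_supC hN hne hu2 (t/3+t)
  obtain ⟨R2, hR2⟩ := exists_infC hV2 hs2 (by linarith : t/3 < t/3+t)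
  obtain ⟨q2, hq2L, hup2, hlow2⟩ := cp_R hV2 hR2 hs2 (by linarith : t/3 < t/3+t)
  have hge1 : ∀ z, ∀ y ∈ N, u1 y - ‖z-y‖^2/(2*t) ≤ R1 z := fun z y hy => IsInfC.ge hV1 hR1 ht ht z y hy
  have hge2 : ∀ z, ∀ y ∈ N, u2 y - ‖z-y‖^2/(2*t) ≤ R2 z := fun z y hy => IsInfC.ge hV2 hR2 hs2 ht z y hy
  have hU1 : ∀ x, U1 x ≤ R1 x := by
    intro x
    obtain ⟨y, hy, he⟩ := h1.2 x
    rw [he]; exact hge1 x y hy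
  have hU2 : ∀ x, U2 x ≤ R2 x := by
    intro x
    obtain ⟨y, hy, he⟩ := h2.2 x
    rw [he]; exact hge2 x y hy
  have mk : ∀ {u R : E → ℝ} {q : E → E} {a b : ℝ}, 0 ≤ b →
      (∃ K, LipschitzWith K q) → (∀ y y', R y' ≤ R y + inner ℝ (q y) (y'-y) + a*‖y'-y‖^2) →
      (∀ y y', R y + inner ℝ (q y) (y'-y) - (a+b)*‖y'-y‖^2 ≤ R y') →
      (∀ z, ∀ y ∈ N, u y - ‖z-y‖^2/(2*t) ≤ R z) → CpReg N u t R q := by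
    intro u R q a b hb a1 a2 a3 a4
    refine ⟨a1, ⟨a+b, fun y y' => ?_, a3⟩, a4⟩
    have := a2 y y'
    nlinarith [mul_nonneg hb (sq_nonneg ‖y'-y‖)]
  refine ⟨R1, R2, q1, q2, mk (by rw [add_sub_cancel_left]; positivity) hq1L hup1 hlow1 hge1,
    mk (by rw [add_sub_cancel_left]; positivity) hq2L hup2 hlow2 hge2, ?_⟩
  intro ξ xb hmax
  set M := U1 xb + U2 xb + inner ℝ ξ xb with hM
  have s1 : ∀ y, R1 y ≤ M - inner ℝ ξ y - U2 y := by
    intro y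
    obtain ⟨c, hc, he⟩ := h2.2 y
    refine cp_sandwich (G := fun y => M - inner ℝ ξ y - U2 y) (A := 1/(2*t)) h1 hV1 hR1 ht ht
      (fun x => by linarith [hmax x]) (by field_simp; exact le_refl _) y ((1/t)•(y-c) - ξ) ?_
    intro y'
    have a1 := h2.1 y' c hc
    rw [cp_parab t y y' c] at a1
    rw [inner_sub_left, inner_sub_right ξ]
    linarith
  have s2 : ∀ y, R2 y ≤ M - inner ℝ ξ y - R1 y := by
    intro y
    refine cp_sandwich (G := fun y => M - inner ℝ ξ y - R1 y) (A := 1/(2*t)+1/(t+t-t)) h2 hV2 hR2 hs2 ht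
      (fun x => by linarith [s1 x]) ?_ y (- q1 y - ξ) ?_
    · rw [add_sub_cancel_left]; field_simp; norm_num
    intro y'
    have a1 := hlow1 y y'
    rw [inner_sub_left, inner_sub_right ξ, inner_neg_left]
    linarith
  have b1 := s2 xb
  have b2 := hU1 xb
  have b3 := hU2 xb
  have c1 : R1 xb = U1 xb := by linarith
  have c2 : R2 xb = U2 xb := by linarith
  refine ⟨c1, c2, fun x => ?_⟩
  rw [c1, c2]
  linarith [s2 x]
end SG

section SH
variable {E : Type*} [NormedAddCommGroup E] [InnerProductSpace ℝ E] [FiniteDimensional ℝ E]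
variable [MeasurableSpace E] [BorelSpace E] (μ : Measure E) [μ.IsAddHaarMeasure]

lemma cp_D {Ω N O : Set E} {u1 u2 U1 U2 : E → ℝ} {lam Lam : ℝ} {Φ : (E →L[ℝ] E) → ℝ} {ε t m H0 κ : ℝ}
    {h : E → E → ℝ} (hΩ : IsOpen Ω) (hΩN : Ω ⊆ N) (hN : IsCompact N) (hne : N.Nonempty)
    (hu1 : UpperSemicontinuousOn u1 N) (hu2 : UpperSemicontinuousOn u2 N)
    (hO : IsOpen O) (hOΩ : O ⊆ Ω) (hlam : 0 < lam)
    (hΦ : EllOp lam Lam Φ)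
    (hJ1 : CpJet Ω u1 Φ ε h) (hJ2 : CpJet Ω u2 (fun T => - Φ (-T)) ε (fun y p => - h y (-p)))
    (hε : 0 ≤ ε) (hm : 0 ≤ m) (hH0 : 0 ≤ H0) (hH : ∀ y ∈ Ω, ∀ p, |h y p| ≤ H0)
    (ht : 0 < t) (ht1 : t ≤ 1)
    (h1 : IsSupC N u1 t U1) (h2 : IsSupC N u2 t U2)
    (hex : ∀ ξ ∈ ball (0:E) κ, ∃ xb, ∀ x, U1 x + U2 x + inner ℝ ξ x ≤ U1 xb + U2 xb + inner ℝ ξ xb)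
    (hcon : ∀ ξ ∈ ball (0:E) κ, ∀ xb, (∀ x, U1 x + U2 x + inner ℝ ξ x ≤ U1 xb + U2 xb + inner ℝ ξ xb) →
      ∀ y1 ∈ N, ∀ y2 ∈ N, U1 xb = u1 y1 - ‖xb-y1‖^2/(2*t) → U2 xb = u2 y2 - ‖xb-y2‖^2/(2*t) →
      y1 ∈ Ω ∧ y2 ∈ Ω ∧ -m < u1 y1 ∧ -m < u2 y2 ∧ 0 ≤ u1 y1 + u2 y2)
    (hsmall : ENNReal.ofReal ((2*H0/lam)^(Module.finrank ℝ E)) * 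
      (ENNReal.ofReal (((H0 + ε*m + Lam * Module.finrank ℝ E)/lam)^(Module.finrank ℝ E)) * μ O +
       ENNReal.ofReal (((H0 + ε*m + Lam * Module.finrank ℝ E)/lam)^(Module.finrank ℝ E)) * μ O)
        < μ (ball (0:E) κ)) :
    ∃ ξ ∈ ball (0:E) κ, ∃ xb, (∀ x, U1 x + U2 x + inner ℝ ξ x ≤ U1 xb + U2 xb + inner ℝ ξ xb) ∧
      ∃ y1 ∈ Ω \ O, ∃ y2 ∈ Ω \ O, U1 xb = u1 y1 - ‖xb-y1‖^2/(2*t) ∧ U2 xb = u2 y2 - ‖xb-y2‖^2/(2*t) ∧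
      ∃ p1 p2, p1 + p2 = - ξ ∧ ε * (u1 y1 + u2 y2) ≤ h y1 p1 - h y2 (-p2) := by
  obtain ⟨R1, R2, q1, q2, hR1, hR2, hR⟩ := cp_pair hN hne hu1 hu2 ht h1 h2
  set D : Set E := {x | ¬ DifferentiableAt ℝ q1 x} ∪ {x | ¬ DifferentiableAt ℝ q2 x} with hD
  obtain ⟨K1, hK1⟩ := hR1.1
  obtain ⟨K2, hK2⟩ := hR2.1
  have hDn : μ D = 0 := by
    refine measure_union_null ?_ ?_
    · exact hK1.ae_differentiableAt (μ := μ)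
    · exact hK2.ae_differentiableAt (μ := μ)
  set Ψ : E → E := fun x => -(q1 x + q2 x) with hΨ
  have hΨL : LipschitzWith (K1+K2) Ψ := (hK1.add hK2).neg
  -- pointwise facts
  have fact : ∀ ξ ∈ ball (0:E) κ, ∀ xb, (∀ x, U1 x + U2 x + inner ℝ ξ x ≤ U1 xb + U2 xb + inner ℝ ξ xb) →
      Ψ xb = ξ := by
    intro ξ hξ xb hmax
    obtain ⟨e1, e2, e3⟩ := hR ξ xb hmax
    obtain ⟨_, ⟨C1, _, hl1⟩, _⟩ := hR1
    obtain ⟨_, ⟨C2, _, hl2⟩, _⟩ := hR2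
    have : q1 xb + q2 xb + ξ = 0 := by
      apply cp_lin (C := C1 + C2)
      intro w
      have a1 := hl1 xb (xb+w)
      have a2 := hl2 xb (xb+w)
      have a3 := e3 (xb+w)
      simp only [add_sub_cancel_left, inner_add_right] at a1 a2 a3
      rw [inner_add_left, inner_add_left]
      linarith
    simp only [hΨ]
    exact neg_eq_of_add_eq_zero_right this
  have fact2 : ∀ ξ ∈ ball (0:E) κ, ∀ xb, (∀ x, U1 x + U2 x + inner ℝ ξ x ≤ U1 xb + U2 xb + inner ℝ ξ xb) →
      xb ∉ D → ∀ y1 ∈ N, ∀ y2 ∈ N, U1 xb = u1 y1 - ‖xb-y1‖^2/(2*t) → U2 xb = u2 y2 - ‖xb-y2‖^2/(2*t) →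
      ε * (u1 y1 + u2 y2) ≤ h y1 (q1 xb) - h y2 (-q2 xb) ∧
      |(fderiv ℝ Ψ xb).det| ≤ (2*H0/lam)^(Module.finrank ℝ E) := by
    intro ξ hξ xb hmax hxD y1 hy1 y2 hy2 hc1 hc2
    obtain ⟨e1, e2, e3⟩ := hR ξ xb hmax
    obtain ⟨hy1Ω, hy2Ω, hm1, hm2, hpos⟩ := hcon ξ hξ xb hmax y1 hy1 y2 hy2 hc1 hc2
    have hd1 : DifferentiableAt ℝ q1 xb := by
      by_contra hc; exact hxD (Or.inl hc)
    have hd2 : DifferentiableAt ℝ q2 xb := by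
      by_contra hc; exact hxD (Or.inr hc)
    set T1 := fderiv ℝ q1 xb with hT1
    set T2 := fderiv ℝ q2 xb with hT2
    have hT1' : HasFDerivAt q1 T1 xb := hd1.hasFDerivAt
    have hT2' : HasFDerivAt q2 T2 xb := hd2.hasFDerivAt
    obtain ⟨s1, j1⟩ := cp_touch hΩ hΦ hJ1 hy1Ω hR1.hasF hT1'
      (fun y' hy' => hR1.touch (e1.trans hc1) y' (hΩN hy'))
    obtain ⟨s2, j2⟩ := cp_touch hΩ hΦ.dual hJ2 hy2Ω hR2.hasF hT2'
      (fun y' hy' => hR2.touch (e2.trans hc2) y' (hΩN hy'))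
    have hξ' := fact ξ hξ xb hmax
    have hRR : ∀ y, HasFDerivAt (fun x => R1 x + R2 x) (innerSL ℝ ((fun x => q1 x + q2 x) y)) y := by
      intro y
      have := (hR1.hasF y).add (hR2.hasF y)
      simp only [map_add]
      exact this
    have hTle := cp_Tle (C := 0) hRR (hT1'.add hT2') (by
      intro y'
      have := e3 y'
      have e4 : q1 xb + q2 xb = - ξ := by rw [← hξ']; simp [hΨ]
      simp only [e4, inner_neg_left, inner_sub_right, zero_mul]
      linarith)
    set P := -(T1 + T2) with hP
    have hPs : CSym P := (s1.add s2).neg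
    have hP0 : ∀ x, 0 ≤ inner ℝ (P x) x := by
      intro x
      have := hTle x
      simp only [hP, neg_apply, inner_neg_left]
      linarith
    have hel := (hΦ.2.2 T1 P s1 hPs hP0).1
    have eTP : T1 + P = -T2 := by rw [hP]; abel
    rw [eTP] at hel
    obtain ⟨htr, hdet⟩ := cp_det hPs hP0
    have hb1 := (abs_le.1 (hH y1 hy1Ω (q1 xb))).2
    have hb2 := (abs_le.1 (hH y2 hy2Ω (-q2 xb))).1
    have hlt : 0 ≤ lam * CTr P := by positivity
    constructor
    · linarith
    · have hfd : fderiv ℝ Ψ xb = P := ((hT1'.add hT2').neg).fderiv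
      rw [hfd]
      refine hdet.trans (pow_le_pow_left₀ htr ?_ _)
      rw [le_div_iff₀ hlam]
      have : 0 ≤ ε * (u1 y1 + u2 y2) := by positivity
      linarith
  by_contra hno
  push Not at hno
  set S1 : Set E := {x | ∃ y ∈ O, -m < u1 y ∧
        ∀ y' ∈ N, y' ≠ y → u1 y' - ‖x-y'‖^2/(2*t) < u1 y - ‖x-y‖^2/(2*t)} with hS1
  set S2 : Set E := {x | ∃ y ∈ O, -m < u2 y ∧
        ∀ y' ∈ N, y' ≠ y → u2 y' - ‖x-y'‖^2/(2*t) < u2 y - ‖x-y‖^2/(2*t)} with hS2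
  have hS1m : μ S1 ≤ _ := cp_S2 μ hΩ hΩN hN hne hu1 hO hOΩ hlam hΦ hJ1 hε hm hH0 hH ht ht1
  have hS2m : μ S2 ≤ _ := cp_S2 μ hΩ hΩN hN hne hu2 hO hOΩ hlam hΦ.dual hJ2 hε hm hH0
    (by intro y hy p; rw [abs_neg]; exact hH y hy _) ht ht1
  set S : Set E := {x | x ∉ D ∧ x ∈ S1 ∪ S2 ∧ ∃ ξ ∈ ball (0:E) κ, 
    ∀ x', U1 x' + U2 x' + inner ℝ ξ x' ≤ U1 x + U2 x + inner ℝ ξ x} with hS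
  have himg : μ (Ψ '' S) ≤ ENNReal.ofReal ((2*H0/lam)^(Module.finrank ℝ E)) * μ S := by
    apply cp_img μ hΨL
    rintro x ⟨hxD, _, ξ, hξ, hmax⟩ _
    obtain ⟨y1, hy1, hc1⟩ := h1.2 x
    obtain ⟨y2, hy2, hc2⟩ := h2.2 x
    exact (fact2 ξ hξ x hmax hxD y1 hy1 y2 hy2 hc1 hc2).2
  have hcov : ball (0:E) κ ⊆ Ψ '' S ∪ Ψ '' D := by
    intro ξ hξ
    obtain ⟨xb, hmax⟩ := hex ξ hξ
    have hΨx := fact ξ hξ xb hmax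
    by_cases hxD : xb ∈ D
    · exact Or.inr ⟨xb, hxD, hΨx⟩
    refine Or.inl ⟨xb, ⟨hxD, ?_, ξ, hξ, hmax⟩, hΨx⟩
    obtain ⟨y1, hy1, hc1⟩ := h1.2 xb
    obtain ⟨y2, hy2, hc2⟩ := h2.2 xb
    obtain ⟨e1, e2, e3⟩ := hR ξ xb hmax
    obtain ⟨hy1Ω, hy2Ω, hm1, hm2, hpos⟩ := hcon ξ hξ xb hmax y1 hy1 y2 hy2 hc1 hc2
    by_cases ho1 : y1 ∈ O
    · exact Or.inl ⟨y1, ho1, hm1, hR1.strict ht hy1 (e1.trans hc1)⟩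
    by_cases ho2 : y2 ∈ O
    · exact Or.inr ⟨y2, ho2, hm2, hR2.strict ht hy2 (e2.trans hc2)⟩
    exfalso
    have h3 := hno ξ hξ xb hmax y1 ⟨hy1Ω, ho1⟩ y2 ⟨hy2Ω, ho2⟩ hc1 hc2 (q1 xb) (q2 xb)
      (by rw [← hΨx]; simp [hΨ])
    exact absurd (fact2 ξ hξ xb hmax hxD y1 hy1 y2 hy2 hc1 hc2).1 (not_le.2 h3)
  have : μ (ball (0:E) κ) ≤ ENNReal.ofReal ((2*H0/lam)^(Module.finrank ℝ E)) * 
      (ENNReal.ofReal (((H0 + ε*m + Lam * Module.finrank ℝ E)/lam)^(Module.finrank ℝ E)) * μ O +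
       ENNReal.ofReal (((H0 + ε*m + Lam * Module.finrank ℝ E)/lam)^(Module.finrank ℝ E)) * μ O) := by
    calc μ (ball (0:E) κ) ≤ μ (Ψ '' S ∪ Ψ '' D) := measure_mono hcov
      _ ≤ μ (Ψ '' S) + μ (Ψ '' D) := measure_union_le _ _
      _ = μ (Ψ '' S) := by rw [cp_null μ hΨL hDn, add_zero]
      _ ≤ _ := himg
      _ ≤ _ := by
        refine mul_le_mul' le_rfl ?_
        calc μ S ≤ μ (S1 ∪ S2) := measure_mono fun x hx => hx.2.1
          _ ≤ μ S1 + μ S2 := measure_union_le _ _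
          _ ≤ _ := add_le_add hS1m hS2m
  exact absurd hsmall (not_lt.2 this)
end SH

section SI
variable {E : Type*} [NormedAddCommGroup E] [InnerProductSpace ℝ E] [FiniteDimensional ℝ E]

lemma cp_usc2 {N : Set E} {u1 u2 : E → ℝ} 
    (hu1 : UpperSemicontinuousOn u1 N) (hu2 : UpperSemicontinuousOn u2 N) :
    UpperSemicontinuousOn (fun z : E × E => u1 z.1 + u2 z.2) (N ×ˢ N) := by
  have a1 : UpperSemicontinuousOn (u1 ∘ Prod.fst) (N ×ˢ N) :=
    UpperSemicontinuousOn.comp hu1 continuousOn_fst (fun z hz => hz.1)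
  have a2 : UpperSemicontinuousOn (u2 ∘ Prod.snd) (N ×ˢ N) :=
    UpperSemicontinuousOn.comp hu2 continuousOn_snd (fun z hz => hz.2)
  exact a1.add a2

lemma cp_exmax {N : Set E} (hN : IsCompact N) (hne : N.Nonempty) {u1 u2 U1 U2 : E → ℝ}
    (hu1 : UpperSemicontinuousOn u1 N) (hu2 : UpperSemicontinuousOn u2 N) {t : ℝ} (ht : 0 < t)
    (h1 : IsSupC N u1 t U1) (h2 : IsSupC N u2 t U2) (ξ : E) :
    ∃ xb, ∀ x, U1 x + U2 x + inner ℝ ξ x ≤ U1 xb + U2 xb + inner ℝ ξ xb := by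
  set X : E × E → E := fun z => (1/2:ℝ)•(z.1+z.2) + (t/2)•ξ with hX
  have hXc : Continuous X := by fun_prop
  set c : E × E → ℝ := fun z => -(‖X z - z.1‖^2/(2*t)) - ‖X z - z.2‖^2/(2*t) + inner ℝ ξ (X z) with hc
  have hcc : Continuous c := by fun_prop
  obtain ⟨z, hz, hmax⟩ := UpperSemicontinuousOn.exists_isMaxOn (hne.prod hne) (hN.prod hN)
    ((cp_usc2 hu1 hu2).add hcc.continuousOn.upperSemicontinuousOn)
  refine ⟨X z, fun x => ?_⟩
  obtain ⟨y1, hy1, e1⟩ := h1.2 x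
  obtain ⟨y2, hy2, e2⟩ := h2.2 x
  have b1 := h1.1 (X z) z.1 hz.1
  have b2 := h2.1 (X z) z.2 hz.2
  have b3 : u1 y1 + u2 y2 + c (y1,y2) ≤ u1 z.1 + u2 z.2 + c z := hmax (mk_mem_prod hy1 hy2)
  have key : -(‖x - y1‖^2/(2*t)) - ‖x - y2‖^2/(2*t) + inner ℝ ξ x ≤ c (y1, y2) := by
    set w := x - X (y1,y2) with hw
    have ex : x = X (y1,y2) + w := by rw [hw]; abel
    have p1 := cp_parab t (X (y1,y2)) x y1
    have p2 := cp_parab t (X (y1,y2)) x y2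
    rw [← hw] at p1 p2
    have e3 : inner ℝ ((1/t)•(X (y1,y2)-y1)) w + inner ℝ ((1/t)•(X (y1,y2)-y2)) w = inner ℝ ξ w := by
      rw [← inner_add_left, ← smul_add]
      congr 1
      have : X (y1,y2) - y1 + (X (y1,y2) - y2) = t • ξ := by
        simp only [hX]
        module
      rw [this, smul_smul, one_div_mul_cancel ht.ne', one_smul]
    have e4 : inner ℝ ξ x = inner ℝ ξ (X (y1,y2)) + inner ℝ ξ w := by
      rw [← inner_add_right, ← ex]
    have e5 : 0 ≤ 1/(2*t)*‖w‖^2 := by positivity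
    simp only [hc]
    rw [p1, p2, e4]
    linarith
  simp only [hc] at b3 key
  linarith

lemma cp_bdd {N : Set E} (hN : IsCompact N) {u : E → ℝ} (hu : UpperSemicontinuousOn u N) :
    ∃ K, ∀ y ∈ N, u y ≤ K := by
  rcases N.eq_empty_or_nonempty with rfl | hne
  · exact ⟨0, by simp⟩
  obtain ⟨a, ha, hm⟩ := UpperSemicontinuousOn.exists_isMaxOn hne hN hu
  exact ⟨u a, fun y hy => hm hy⟩

lemma cp_inside {Ω N : Set E} (hΩ : IsOpen Ω) (hN : IsCompact N) {u1 u2 : E → ℝ}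
    (hu1 : UpperSemicontinuousOn u1 N) (hu2 : UpperSemicontinuousOn u2 N)
    (hb : ∀ y ∈ N, y ∉ Ω → u1 y + u2 y ≤ 0) {c : ℝ} (hc : 0 < c) :
    ∃ ρ > 0, ∀ y1 ∈ N, ∀ y2 ∈ N, ‖y1-y2‖ < ρ → c ≤ u1 y1 + u2 y2 → y1 ∈ Ω ∧ y2 ∈ Ω := by
  set A := (N ×ˢ N) ∩ (fun z : E × E => u1 z.1 + u2 z.2) ⁻¹' Ici c with hA
  have hAc : IsCompact A := (cp_usc2 hu1 hu2).isCompact_inter_preimage_Ici (hN.prod hN) c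
  set B := A ∩ (Ω ×ˢ Ω)ᶜ with hB
  have hBc : IsCompact B := hAc.inter_right (hΩ.prod hΩ).isClosed_compl
  rcases B.eq_empty_or_nonempty with he | hne
  · refine ⟨1, one_pos, fun y1 hy1 y2 hy2 _ hcc => ?_⟩
    by_contra hcon
    have : (y1,y2) ∈ B := ⟨⟨⟨hy1, hy2⟩, hcc⟩, fun h => hcon h⟩
    rw [he] at this
    exact this
  · obtain ⟨z, hz, hmin⟩ := hBc.exists_isMinOn hne (f := fun z : E × E => ‖z.1 - z.2‖) (by fun_prop)
    have hz0 : 0 < ‖z.1 - z.2‖ := by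
      rw [norm_pos_iff, sub_ne_zero]
      intro he
      have h1 : z.1 ∉ Ω := fun h => hz.2 ⟨h, he ▸ h⟩
      have h2 := hb z.1 hz.1.1.1 h1
      have h3 : c ≤ u1 z.1 + u2 z.2 := hz.1.2
      rw [← he] at h3
      linarith
    refine ⟨_, hz0, fun y1 hy1 y2 hy2 hlt hcc => ?_⟩
    by_contra hcon
    have : (y1,y2) ∈ B := ⟨⟨⟨hy1, hy2⟩, hcc⟩, fun h => hcon h⟩
    have := hmin this
    exact absurd hlt (not_lt.2 this)

variable [MeasurableSpace E] [BorelSpace E] (μ : Measure E) [μ.IsAddHaarMeasure]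

theorem cp_main {Ω N : Set E} {u1 u2 : E → ℝ} {lam Lam : ℝ} {Φ : (E →L[ℝ] E) → ℝ} {ε H0 : ℝ}
    {h : E → E → ℝ} (hΩ : IsOpen Ω) (hΩN : Ω ⊆ N) (hN : IsCompact N)
    (hu1 : UpperSemicontinuousOn u1 N) (hu2 : UpperSemicontinuousOn u2 N)
    (hlam : 0 < lam) (hΦ : EllOp lam Lam Φ)
    (hJ1 : CpJet Ω u1 Φ ε h) (hJ2 : CpJet Ω u2 (fun T => - Φ (-T)) ε (fun y p => - h y (-p)))
    (hε : 0 < ε) (hH0 : 0 ≤ H0) (hH : ∀ y ∈ Ω, ∀ p, |h y p| ≤ H0)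
    (hi : ∀ e > 0, ∃ κ > 0, ∀ y ∈ Ω, ∀ p p', ‖p-p'‖ < κ → |h y p - h y p'| ≤ e)
    (hii : ∀ η : NNReal, 0 < η → ∀ e > 0, ∃ K, IsClosed K ∧ μ (Ω \ K) ≤ η ∧ ∃ ρ > 0,
      ∀ y ∈ K ∩ Ω, ∀ y' ∈ K ∩ Ω, ‖y-y'‖ < ρ → ∀ p, |h y p - h y' p| ≤ e)
    (hb : ∀ y ∈ N, y ∉ Ω → u1 y + u2 y ≤ 0) :
    ∀ x ∈ Ω, u1 x + u2 x ≤ 0 := by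
  intro x0 hx0
  by_contra hpos
  push Not at hpos
  have hne : N.Nonempty := ⟨x0, hΩN hx0⟩
  set M0 := u1 x0 + u2 x0 with hM0
  obtain ⟨Ka, hKa⟩ := cp_bdd hN hu1
  obtain ⟨Kc, hKc⟩ := cp_bdd hN hu2
  obtain ⟨Db, hDb0, hDb⟩ : ∃ D : ℝ, 0 ≤ D ∧ ∀ y ∈ N, ‖y‖ ≤ D := by
    obtain ⟨D, hD⟩ := hN.isBounded.exists_norm_le
    exact ⟨max D 0, le_max_right _ _, fun y hy => (hD y hy).trans (le_max_left _ _)⟩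
  set Kb := max (max Ka Kc) 0 with hKb
  have hKb0 : 0 ≤ Kb := le_max_right _ _
  have hK1 : ∀ y ∈ N, u1 y ≤ Kb := fun y hy =>
    (hKa y hy).trans ((le_max_left _ _).trans (le_max_left _ _))
  have hK2 : ∀ y ∈ N, u2 y ≤ Kb := fun y hy =>
    (hKc y hy).trans ((le_max_right _ _).trans (le_max_left _ _))
  have he0 : 0 < ε * M0 / 8 := by positivity
  obtain ⟨κ0, hκ0, hκ⟩ := hi _ he0
  set κ := min κ0 (min 1 (M0/(2*(2*Db+1)))) with hκdef
  have hκpos : 0 < κ := by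
    refine lt_min hκ0 (lt_min one_pos ?_)
    positivity
  have hκ1 : κ ≤ 1 := (min_le_right _ _).trans (min_le_left _ _)
  have hκ2 : κ * (2*Db+1) ≤ M0/2 := by
    have : κ ≤ M0/(2*(2*Db+1)) := (min_le_right _ _).trans (min_le_right _ _)
    calc κ * (2*Db+1) ≤ M0/(2*(2*Db+1)) * (2*Db+1) := by gcongr
      _ = M0/2 := by field_simp
  have hball : μ (ball (0:E) κ) ≠ 0 := (measure_ball_pos μ 0 hκpos).ne'
  set A := ENNReal.ofReal ((2*H0/lam)^(Module.finrank ℝ E)) with hA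
  set B := ENNReal.ofReal (((H0 + ε*Kb + Lam * Module.finrank ℝ E)/lam)^(Module.finrank ℝ E)) with hB
  obtain ⟨η, hη, hηs⟩ := ENNReal.exists_nnreal_pos_mul_lt (a := A * (B + B)) (by
    exact ENNReal.mul_ne_top ENNReal.ofReal_ne_top (ENNReal.add_ne_top.2 ⟨ENNReal.ofReal_ne_top, ENNReal.ofReal_ne_top⟩)) hball
  obtain ⟨K, hKcl, hKm, ρ, hρ, hKρ⟩ := hii η hη _ he0
  obtain ⟨ρ1, hρ1, hin⟩ := cp_inside hΩ hN hu1 hu2 hb (half_pos hpos)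
  set C' := 2*Kb + 2*Db + 1 with hC'
  have hC'0 : 0 < C' := by positivity
  set ρ2 := min 1 (min ρ ρ1) with hρ2
  have hρ20 : 0 < ρ2 := lt_min one_pos (lt_min hρ hρ1)
  have hρ21 : ρ2 ≤ 1 := min_le_left _ _
  -- choose t with 4 C' t ≤ (ρ2/3)^2
  set t := min 1 ((ρ2/3)^2/(4*C')) with ht
  have ht0 : 0 < t := lt_min one_pos (by positivity)
  have ht1 : t ≤ 1 := min_le_left _ _
  have ht2 : 4*C'*t ≤ (ρ2/3)^2 := by
    have : t ≤ (ρ2/3)^2/(4*C') := min_le_right _ _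
    rw [le_div_iff₀ (by positivity)] at this
    linarith
  obtain ⟨U1, h1⟩ := exists_supC hN hne hu1 t
  obtain ⟨U2, h2⟩ := exists_supC hN hne hu2 t
  have est : ∀ ξ ∈ ball (0:E) κ, ∀ xb, (∀ x, U1 x + U2 x + inner ℝ ξ x ≤ U1 xb + U2 xb + inner ℝ ξ xb) →
      ∀ y1 ∈ N, ∀ y2 ∈ N, U1 xb = u1 y1 - ‖xb-y1‖^2/(2*t) → U2 xb = u2 y2 - ‖xb-y2‖^2/(2*t) →
      ‖y1 - y2‖ < ρ2 ∧ M0/2 ≤ u1 y1 + u2 y2 := by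
    intro ξ hξ xb hmax y1 hy1 y2 hy2 hc1 hc2
    have hξn : ‖ξ‖ ≤ κ := by simpa using (mem_ball_zero_iff.1 hξ).le
    have a1 := hmax x0
    have a2 := h1.1 x0 x0 (hΩN hx0)
    have a3 := h2.1 x0 x0 (hΩN hx0)
    simp only [sub_self, norm_zero, ne_eq, OfNat.ofNat_ne_zero, not_false_eq_true, zero_pow, zero_div,
      sub_zero] at a2 a3
    have a4 : inner ℝ ξ xb - inner ℝ ξ x0 ≤ κ * ‖xb - x0‖ := by
      rw [← inner_sub_right]
      exact (real_inner_le_norm _ _).trans (by gcongr)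
    have tri : ∀ y ∈ N, ‖xb - x0‖ ≤ 2*Db + ‖xb - y‖ := by
      intro y hy
      have e : xb - x0 = (xb - y) + (y - x0) := by abel
      rw [e]
      have := norm_add_le (xb-y) (y-x0)
      have := norm_sub_le y x0
      linarith [hDb y hy, hDb x0 (hΩN hx0)]
    have key : M0 + ‖xb-y1‖^2/(2*t) + ‖xb-y2‖^2/(2*t) ≤ u1 y1 + u2 y2 + κ * ‖xb - x0‖ := by
      linarith
    have hbd : ∀ y ∈ N, ‖xb-y‖^2/(2*t) ≤ 2*Kb + κ * ‖xb - x0‖ → ‖xb - y‖ ≤ ρ2/3 := by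
      intro y hy hle
      set d := ‖xb - y‖ with hd
      have hd0 : 0 ≤ d := norm_nonneg _
      have c1 : d^2/(2*t) ≤ 2*Kb + (2*Db + d) := by
        have : κ * ‖xb - x0‖ ≤ 1 * (2*Db + d) := by
          apply mul_le_mul hκ1 (tri y hy) (norm_nonneg _) zero_le_one
        linarith
      rw [div_le_iff₀ (by positivity)] at c1
      have c2 : d^2 ≤ (ρ2/3)^2 := by
        refine le_trans ?_ ht2
        nlinarith [sq_nonneg (d - 2*t), mul_pos ht0 ht0]
      exact abs_le_of_sq_le_sq' c2 (by positivity) |>.2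
    have p1 : 0 ≤ ‖xb-y1‖^2/(2*t) := by positivity
    have p2 : 0 ≤ ‖xb-y2‖^2/(2*t) := by positivity
    have d1 := hbd y1 hy1 (by linarith [hK1 y1 hy1, hK2 y2 hy2])
    have d2 := hbd y2 hy2 (by linarith [hK1 y1 hy1, hK2 y2 hy2])
    constructor
    · have e : y1 - y2 = (xb - y2) - (xb - y1) := by abel
      rw [e]
      have := norm_sub_le (xb-y2) (xb-y1)
      linarith
    · have : κ * ‖xb - x0‖ ≤ κ * (2*Db+1) := by
        gcongr
        have := tri y1 hy1
        linarith
      linarith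
  obtain ⟨ξ, hξ, xb, hmax, y1, hy1, y2, hy2, hc1, hc2, p1, p2, hp, hfin⟩ :=
    cp_D μ (m := Kb) (O := Ω \ K) (κ := κ) hΩ hΩN hN hne hu1 hu2 (hΩ.sdiff hKcl) sdiff_subset hlam hΦ hJ1 hJ2
      hε.le hKb0 hH0 hH ht0 ht1 h1 h2 (fun ξ _ => cp_exmax hN hne hu1 hu2 ht0 h1 h2 ξ) (by
        intro ξ hξ xb hmax y1 hy1 y2 hy2 hc1 hc2
        obtain ⟨g1, g2⟩ := est ξ hξ xb hmax y1 hy1 y2 hy2 hc1 hc2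
        have g1' : ‖y1 - y2‖ < ρ1 := lt_of_lt_of_le g1 ((min_le_right _ _).trans (min_le_right _ _))
        obtain ⟨i1, i2⟩ := hin y1 hy1 y2 hy2 g1' g2
        refine ⟨i1, i2, ?_, ?_, ?_⟩ <;> linarith [hK1 y1 hy1, hK2 y2 hy2]) (by
        refine lt_of_le_of_lt ?_ hηs
        rw [← add_mul, mul_comm (η:ENNReal), mul_assoc]
        exact mul_le_mul' le_rfl (mul_le_mul' le_rfl hKm))
  obtain ⟨g1, g2⟩ := est ξ hξ xb hmax y1 (hΩN hy1.1) y2 (hΩN hy2.1) hc1 hc2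
  have k1 : y1 ∈ K := by by_contra hc; exact hy1.2 ⟨hy1.1, hc⟩
  have k2 : y2 ∈ K := by by_contra hc; exact hy2.2 ⟨hy2.1, hc⟩
  have f1 := hκ y1 hy1.1 p1 (-p2) (by
    rw [sub_neg_eq_add, hp, norm_neg]
    exact lt_of_lt_of_le (mem_ball_zero_iff.1 hξ) (min_le_left _ _))
  have f2 := hKρ y1 ⟨k1, hy1.1⟩ y2 ⟨k2, hy2.1⟩ (lt_of_lt_of_le g1 ((min_le_right _ _).trans (min_le_left _ _))) (-p2)
  have f3 := (abs_le.1 f1).2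
  have f4 := (abs_le.1 f2).2
  have f5 : ε * (M0/2) ≤ ε * (u1 y1 + u2 y2) := mul_le_mul_of_nonneg_left g2 hε.le
  have : 0 < ε * M0 := by positivity
  linarith
end SI

section SJ
variable {n : ℕ}

def matOf (T : En n →L[ℝ] En n) : Mat n :=
  Matrix.of fun i j => inner ℝ (T (EuclideanSpace.single i (1:ℝ))) (EuclideanSpace.single j (1:ℝ))

lemma matOf_apply (T : En n →L[ℝ] En n) (i j) : matOf T i j =
    inner ℝ (T (EuclideanSpace.single i (1:ℝ))) (EuclideanSpace.single j (1:ℝ)) := rfl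

lemma matOf_add (S T : En n →L[ℝ] En n) : matOf (S + T) = matOf S + matOf T := by
  ext i j; simp only [matOf_apply, Matrix.add_apply, add_apply, inner_add_left]
lemma matOf_neg (T : En n →L[ℝ] En n) : matOf (-T) = - matOf T := by
  ext i j; simp only [matOf_apply, Matrix.neg_apply, neg_apply, inner_neg_left]
lemma matOf_zero : matOf (0 : En n →L[ℝ] En n) = 0 := by
  ext i j; simp [matOf_apply]
lemma matOf_cont : Continuous (matOf (n := n)) := by
  refine continuous_matrix fun i j => ?_
  simp only [matOf_apply]
  fun_prop
lemma matOf_symm {T : En n →L[ℝ] En n} (h : CSym T) : (matOf T).IsSymm := by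
  ext i j
  rw [Matrix.transpose_apply, matOf_apply, matOf_apply, h, real_inner_comm]
lemma matOf_trace (T : En n →L[ℝ] En n) : (matOf T).trace = CTr T := by
  rw [CTr, LinearMap.trace_eq_sum_inner _ (EuclideanSpace.basisFun (Fin n) ℝ), Matrix.trace]
  refine Finset.sum_congr rfl fun i _ => ?_
  rw [Matrix.diag_apply, matOf_apply, EuclideanSpace.basisFun_apply, real_inner_comm]
  rfl
lemma matOf_psd {T : En n →L[ℝ] En n} (h : CSym T) (h0 : ∀ x, 0 ≤ inner ℝ (T x) x) :
    (matOf T).PosSemidef := by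
  refine Matrix.PosSemidef.of_dotProduct_mulVec_nonneg ?_ ?_
  · have := matOf_symm h
    rw [Matrix.IsHermitian, Matrix.conjTranspose_eq_transpose_of_trivial]
    exact this
  intro x
  have h1 := h0 (∑ i, x i • EuclideanSpace.single i (1:ℝ))
  have : inner ℝ (T (∑ i, x i • EuclideanSpace.single i (1:ℝ))) (∑ i, x i • EuclideanSpace.single i (1:ℝ))
      = star x ⬝ᵥ (matOf T).mulVec x := by
    simp only [map_sum, map_smul, sum_inner, inner_sum, inner_smul_left, inner_smul_right, dotProduct,
      Matrix.mulVec, Finset.mul_sum, matOf_apply, conj_trivial, Pi.star_apply, star_trivial]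
    refine Finset.sum_congr rfl fun i _ => Finset.sum_congr rfl fun j _ => ?_
    have e := h (EuclideanSpace.single j (1:ℝ)) (EuclideanSpace.single i (1:ℝ))
    rw [real_inner_comm] at e
    simp only [e, real_inner_comm]
    ring
  rw [← this]; exact h1

lemma cp_ell {lam Lam : ℝ} {F : Mat n → ℝ} (hF : UniformlyElliptic lam Lam F) (hF0 : F 0 = 0) :
    EllOp lam Lam (fun T : En n →L[ℝ] En n => F (matOf T)) := by
  refine ⟨hF.1.comp matOf_cont, by simp [matOf_zero, hF0], fun T P hT hP h0 => ?_⟩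
  have := hF.2 (matOf T) (matOf P) (matOf_symm hT) (matOf_symm hP) (matOf_psd hP h0)
  rw [matOf_trace, ← matOf_add] at this
  exact this

def qf (y0 p : En n) (T : En n →L[ℝ] En n) (y : En n) : ℝ :=
  inner ℝ p (y - y0) + 1/2 * inner ℝ (T (y - y0)) (y - y0)

lemma qf_contDiff (y0 p : En n) (T : En n →L[ℝ] En n) : ContDiff ℝ 2 (qf y0 p T) := by
  have h1 : ContDiff ℝ 2 (fun y : En n => y - y0) := contDiff_id.sub contDiff_const
  have h2 : ContDiff ℝ 2 (fun y : En n => T (y - y0)) := T.contDiff.comp h1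
  exact (contDiff_const.inner ℝ h1).add (contDiff_const.mul (h2.inner ℝ h1))

lemma qf_deriv (y0 p : En n) {T : En n →L[ℝ] En n} (hT : CSym T) (y : En n) :
    HasFDerivAt (qf y0 p T) (innerSL ℝ (p + T (y - y0))) y := by
  have h1 : HasFDerivAt (fun y : En n => y - y0) (ContinuousLinearMap.id ℝ (En n)) y :=
    (hasFDerivAt_id y).sub_const y0
  have h2 : HasFDerivAt (fun y : En n => T (y - y0)) (T ∘SL (ContinuousLinearMap.id ℝ (En n))) y :=
    T.hasFDerivAt.comp y h1
  have h3 := ((hasFDerivAt_const p y).inner ℝ h1).add ((h2.inner ℝ h1).const_mul (1/2))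
  refine h3.congr_fderiv ?_
  ext w
  have e := hT w (y - y0)
  rw [real_inner_comm] at e
  simp [fderivInnerCLM_apply, inner_add_left, inner_sub_left, inner_sub_right] at e ⊢
  have e1 := real_inner_comm (T w) y
  have e2 := real_inner_comm (T w) y0
  have e3 := real_inner_comm (T y) w
  have e4 := real_inner_comm (T y0) w
  linarith

lemma qf_grad (y0 p : En n) {T : En n →L[ℝ] En n} (hT : CSym T) : gradient (qf y0 p T) y0 = p := by
  apply HasGradientAt.gradient
  rw [hasGradientAt_iff_hasFDerivAt]
  have := qf_deriv y0 p hT y0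
  rw [sub_self, map_zero, add_zero] at this
  exact this

lemma qf_hess (y0 p : En n) {T : En n →L[ℝ] En n} (hT : CSym T) :
    hessianMatrix (qf y0 p T) y0 = matOf T := by
  have h1 : fderiv ℝ (qf y0 p T) = fun y => innerSL ℝ (p + T (y - y0)) := by
    funext y; exact (qf_deriv y0 p hT y).fderiv
  have h2 : HasFDerivAt (fun y => innerSL ℝ (p + T (y - y0))) ((innerSL ℝ) ∘SL T) y0 := by
    have h3 : HasFDerivAt (fun y : En n => p + T (y - y0)) T y0 := by
      have h0 : HasFDerivAt (fun y : En n => y - y0) (ContinuousLinearMap.id ℝ (En n)) y0 :=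
        (hasFDerivAt_id y0).sub_const y0
      have h4 : HasFDerivAt (fun y : En n => T (y - y0)) (T ∘SL (ContinuousLinearMap.id ℝ (En n))) y0 :=
        T.hasFDerivAt.comp y0 h0
      rw [ContinuousLinearMap.comp_id] at h4
      exact h4.const_add p
    exact ((innerSL ℝ : En n →L[ℝ] En n →L[ℝ] ℝ).hasFDerivAt).comp y0 h3
  ext i j
  simp only [hessianMatrix, Matrix.of_apply, iteratedFDeriv_two_apply, matOf_apply]
  rw [h1, h2.fderiv]
  simp

def Gr (ε pp pm q s : ℝ) (a b v φε : En n → ℝ) (x z : En n) : ℝ :=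
  ellReg ε z ^ (ε + pp * smoothedChi φε {y | 0 < v y} x + pm * smoothedChi φε {y | v y < 0} x)
        + (ε + a x * smoothedChi φε {y | 0 < v y} x) * ellReg ε z ^ q
        + (ε + b x * smoothedChi φε {y | v y < 0} x) * ellReg ε z ^ s

lemma cp_jet1 {Ω : Set (En n)} {F : Mat n → ℝ} {ε pp pm q s : ℝ} {a b v f φε w : En n → ℝ}
    (hG : ∀ x ∈ Ω, ∀ z, 0 < Gr ε pp pm q s a b v φε x z)
    (hw : ViscSubOn Ω (regOp F ε pp pm q s a b v f φε) w) :
    CpJet Ω w (fun T => F (matOf T)) ε (fun x z => f x / Gr ε pp pm q s a b v φε x z) := by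
  intro y hy p T hT hev
  have h1 := hw (qf y p T) (qf_contDiff y p T) y hy (by
    have : ∀ᶠ y' in 𝓝 y, w y' - qf y p T y' ≤ w y - qf y p T y := by
      filter_upwards [hev] with y' h
      simp [qf] at h ⊢
      linarith
    exact this.filter_mono nhdsWithin_le_nhds)
  rw [qf_grad y p hT, qf_hess y p hT] at h1
  simp only
  rw [le_div_iff₀ (hG y hy p)]
  have h2 : Gr ε pp pm q s a b v φε y p * (ε * w y + F (matOf T)) - f y ≤ 0 := h1
  linarith

lemma cp_jet2 {Ω : Set (En n)} {F : Mat n → ℝ} {ε pp pm q s : ℝ} {a b v f φε w : En n → ℝ}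
    (hG : ∀ x ∈ Ω, ∀ z, 0 < Gr ε pp pm q s a b v φε x z)
    (hw : ViscSupOn Ω (regOp F ε pp pm q s a b v f φε) w) :
    CpJet Ω (-w) (fun T => - F (matOf (-T))) ε
      (fun x z => - (f x / Gr ε pp pm q s a b v φε x (-z))) := by
  intro y hy p T hT hev
  have h1 := hw (qf y (-p) (-T)) (qf_contDiff y (-p) (-T)) y hy (by
    have : ∀ᶠ y' in 𝓝 y, w y - qf y (-p) (-T) y ≤ w y' - qf y (-p) (-T) y' := by
      filter_upwards [hev] with y' h
      simp only [qf, sub_self, map_zero, inner_zero_right, neg_apply, inner_neg_left, Pi.neg_apply, mul_zero, add_zero] at h ⊢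
      linarith
    exact this.filter_mono nhdsWithin_le_nhds)
  rw [qf_grad y _ hT.neg, qf_hess y _ hT.neg] at h1
  simp only [Pi.neg_apply]
  have h2 : 0 ≤ Gr ε pp pm q s a b v φε y (-p) * (ε * w y + F (matOf (-T))) - f y := h1
  have h3 : f y / Gr ε pp pm q s a b v φε y (-p) ≤ ε * w y + F (matOf (-T)) := by
    rw [div_le_iff₀ (hG y hy _)]; linarith
  linarith
end SJ

section SK
variable {n : ℕ}

lemma moll_cs {ε : ℝ} {φ : En n → ℝ} (hφ : IsMollifier ε φ) : HasCompactSupport φ := by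
  refine HasCompactSupport.of_support_subset_isCompact (isCompact_closedBall (0 : En n) ε) ?_
  intro x hx
  rw [mem_closedBall_zero_iff]
  by_contra h
  exact hx (hφ.2.2.2.2 x (not_le.1 h).le)

lemma chi_eq (φ : En n → ℝ) (S : Set (En n)) (x : En n) :
    smoothedChi φ S x = ∫ z, φ (x - z) * S.indicator (fun _ => (1 : ℝ)) z := by
  rw [smoothedChi, ← integral_sub_left_eq_self _ volume x]
  simp only [sub_sub_cancel]

lemma chi_nonneg {ε : ℝ} {φ : En n → ℝ} (hφ : IsMollifier ε φ) (S : Set (En n)) (x : En n) :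
    0 ≤ smoothedChi φ S x :=
  integral_nonneg fun y => mul_nonneg (hφ.2.1 y) (indicator_nonneg (fun _ _ => zero_le_one) _)

lemma chi_le_one {ε : ℝ} {φ : En n → ℝ} (hφ : IsMollifier ε φ) (S : Set (En n)) (x : En n) :
    smoothedChi φ S x ≤ 1 := by
  rw [← hφ.2.2.2.1]
  refine integral_mono_of_nonneg (Filter.Eventually.of_forall fun y =>
    mul_nonneg (hφ.2.1 y) (indicator_nonneg (fun _ _ => zero_le_one) _))
    (hφ.1.continuous.integrable_of_hasCompactSupport (moll_cs hφ))
    (Filter.Eventually.of_forall fun y => ?_)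
  refine mul_le_of_le_one_right (hφ.2.1 y) ?_
  exact indicator_le_self' (fun _ _ => zero_le_one) _ |>.trans le_rfl

def goodA (φ : En n → ℝ) (S : Set (En n)) : Set (En n) :=
  {x | AEStronglyMeasurable (fun z => φ (x - z) * S.indicator (fun _ => (1 : ℝ)) z) volume}

lemma goodA_closed {φ : En n → ℝ} (hφ : Continuous φ) (S : Set (En n)) : IsClosed (goodA φ S) := by
  refine IsSeqClosed.isClosed ?_
  intro u x hu hx
  refine aestronglyMeasurable_of_tendsto_ae Filter.atTop hu (Filter.Eventually.of_forall fun z => ?_)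
  exact ((hφ.tendsto _).comp (hx.sub_const z)).mul_const _

lemma chi_cont {ε : ℝ} {φ : En n → ℝ} (hφ : IsMollifier ε φ) (S : Set (En n)) :
    ContinuousOn (smoothedChi φ S) (goodA φ S) := by
  intro x hx
  have hfun : smoothedChi φ S = fun x => ∫ z, φ (x - z) * S.indicator (fun _ => (1 : ℝ)) z :=
    funext fun x => chi_eq φ S x
  rw [hfun]
  obtain ⟨C, hC⟩ := hφ.1.continuous.bounded_above_of_compact_support (moll_cs hφ)
  refine continuousWithinAt_of_dominated
    (bound := (closedBall x (ε + 1)).indicator (fun _ => C)) ?_ ?_ ?_ ?_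
  · exact self_mem_nhdsWithin
  · have : ball x 1 ∈ 𝓝[goodA φ S] x := mem_nhdsWithin_of_mem_nhds (ball_mem_nhds x one_pos)
    filter_upwards [this] with y hy
    refine Filter.Eventually.of_forall fun z => ?_
    have h0 : ‖S.indicator (fun _ => (1 : ℝ)) z‖ ≤ 1 := by
      by_cases h : z ∈ S <;> simp [h]
    have h1 : ‖φ (y - z) * S.indicator (fun _ => (1 : ℝ)) z‖ ≤ ‖φ (y - z)‖ := by
      rw [norm_mul]; exact mul_le_of_le_one_right (norm_nonneg _) h0
    refine h1.trans ?_
    by_cases hz : z ∈ closedBall x (ε + 1)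
    · rw [indicator_of_mem hz]; exact hC _
    · rw [indicator_of_notMem hz, hφ.2.2.2.2 (y - z), norm_zero]
      rw [mem_closedBall, not_le] at hz
      rw [mem_ball] at hy
      rw [← dist_eq_norm]
      have := dist_triangle z y x
      rw [dist_comm z y] at this
      linarith
  · rw [integrable_indicator_iff measurableSet_closedBall]
    exact integrableOn_const (measure_closedBall_lt_top.ne)
  · refine Filter.Eventually.of_forall fun z => ?_
    have h : Continuous fun y => φ (y - z) * S.indicator (fun _ => (1 : ℝ)) z :=
      (hφ.1.continuous.comp (continuous_id.sub continuous_const)).mul continuous_const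
    exact h.continuousWithinAt

lemma chi_off {φ : En n → ℝ} (S : Set (En n)) {x : En n} (hx : x ∉ goodA φ S) :
    smoothedChi φ S x = 0 := by
  rw [chi_eq]
  exact integral_undef fun h => hx h.1

lemma chi_lusin {ε : ℝ} {φ : En n → ℝ} (hφ : IsMollifier ε φ) (S : Set (En n)) {Ω : Set (En n)}
    (hΩ : IsOpen Ω) (hΩb : Bornology.IsBounded Ω) {η : ENNReal} (hη : η ≠ 0) :
    ∃ K ⊆ Ω, IsCompact K ∧ volume (Ω \ K) ≤ η ∧ ContinuousOn (smoothedChi φ S) K := by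
  have hA := goodA_closed hφ.1.continuous S
  have hfin : volume Ω ≠ ⊤ := hΩb.measure_lt_top.ne
  have hη2 : η / 2 ≠ 0 := by simp [hη]
  obtain ⟨K1, h1s, h1c, h1m⟩ := (hΩ.measurableSet.inter hA.measurableSet).exists_isCompact_diff_lt
    (μ := volume) (measure_ne_top_of_subset inter_subset_left hfin) hη2
  obtain ⟨K2, h2s, h2c, h2m⟩ := (hΩ.measurableSet.diff hA.measurableSet).exists_isCompact_diff_lt
    (μ := volume) (measure_ne_top_of_subset diff_subset hfin) hη2
  refine ⟨K1 ∪ K2, union_subset (h1s.trans inter_subset_left) (h2s.trans diff_subset),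
    h1c.union h2c, ?_, ?_⟩
  · have : Ω \ (K1 ∪ K2) ⊆ ((Ω ∩ goodA φ S) \ K1) ∪ ((Ω \ goodA φ S) \ K2) := by
      intro x hx
      simp only [mem_diff, mem_union, mem_inter_iff] at hx ⊢
      tauto
    refine (measure_mono this).trans ((measure_union_le _ _).trans ?_)
    exact (add_le_add h1m.le h2m.le).trans (ENNReal.add_halves η).le
  · refine ContinuousOn.union_of_isClosed ((chi_cont hφ S).mono (h1s.trans inter_subset_right)) ?_
      h1c.isClosed h2c.isClosed
    exact (continuousOn_const (c := (0:ℝ))).congr fun x hx => chi_off S (h2s hx).2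

lemma ell_ge {ε : ℝ} (z : En n) : ε ≤ ellReg ε z :=
  Real.le_sqrt_of_sq_le (by nlinarith [sq_nonneg ‖z‖])

lemma ell_ge_norm {ε : ℝ} (z : En n) : ‖z‖ ≤ ellReg ε z :=
  Real.le_sqrt_of_sq_le (by nlinarith [sq_nonneg ε])

lemma ell_cont {ε : ℝ} : Continuous (ellReg ε : En n → ℝ) := by
  unfold ellReg; fun_prop

lemma ell_ratio {ε : ℝ} (hε : 0 < ε) (z z' : En n) :
    ellReg ε z ≤ (1 + ‖z - z'‖ / ε) * ellReg ε z' := by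
  have h1 : ellReg ε z ≤ ellReg ε z' + ‖z - z'‖ := by
    have hl := ell_ge_norm (ε := ε) z'
    have hl0 : 0 ≤ ellReg ε z' := hε.le.trans (ell_ge z')
    have hsq : ellReg ε z' ^ 2 = ε ^ 2 + ‖z'‖ ^ 2 := Real.sq_sqrt (by positivity)
    have ht : ‖z‖ ≤ ‖z'‖ + ‖z - z'‖ := by
      have := norm_add_le z' (z - z'); rwa [add_sub_cancel] at this
    refine Real.sqrt_le_iff.2 ⟨by positivity, ?_⟩
    have h2 : ‖z‖ ^ 2 ≤ (‖z'‖ + ‖z - z'‖) ^ 2 := pow_le_pow_left₀ (norm_nonneg _) ht 2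
    nlinarith [mul_le_mul_of_nonneg_right hl (norm_nonneg (z - z'))]
  have h2 : ‖z - z'‖ ≤ ‖z - z'‖ / ε * ellReg ε z' := by
    rw [div_mul_eq_mul_div, le_div_iff₀ hε]
    exact mul_le_mul_of_nonneg_left (ell_ge z') (norm_nonneg _)
  linarith

section Gs
variable {ε pp pm q s : ℝ} {a b v φε : En n → ℝ} {x : En n}
  (hε : ε ∈ Set.Ioo (0:ℝ) 1) (hpp : 0 ≤ pp) (hpm : 0 ≤ pm) (hφ : IsMollifier ε φε)
  (ha : 0 ≤ a x) (hb : 0 ≤ b x)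
include hε hpp hpm hφ

lemma P_ge (x : En n) : ε ≤ ε + pp * smoothedChi φε {y | 0 < v y} x + pm * smoothedChi φε {y | v y < 0} x := by
  have := mul_nonneg hpp (chi_nonneg hφ {y | 0 < v y} x)
  have := mul_nonneg hpm (chi_nonneg hφ {y | v y < 0} x)
  linarith
lemma P_le (x : En n) : ε + pp * smoothedChi φε {y | 0 < v y} x + pm * smoothedChi φε {y | v y < 0} x ≤ ε + pp + pm := by
  have := mul_le_of_le_one_right hpp (chi_le_one hφ {y | 0 < v y} x)
  have := mul_le_of_le_one_right hpm (chi_le_one hφ {y | v y < 0} x)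
  linarith

include ha hb
lemma Gr_ge (z : En n) : ellReg ε z ^ (ε + pp * smoothedChi φε {y | 0 < v y} x + pm * smoothedChi φε {y | v y < 0} x)
    ≤ Gr ε pp pm q s a b v φε x z := by
  have hl : 0 ≤ ellReg ε z := hε.1.le.trans (ell_ge z)
  have h1 := mul_nonneg (add_nonneg hε.1.le (mul_nonneg ha (chi_nonneg hφ {y | 0 < v y} x)))
    (Real.rpow_nonneg hl q)
  have h2 := mul_nonneg (add_nonneg hε.1.le (mul_nonneg hb (chi_nonneg hφ {y | v y < 0} x)))
    (Real.rpow_nonneg hl s)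
  unfold Gr
  linarith

lemma Gr_lower (z : En n) : ε ^ (ε + pp + pm) ≤ Gr ε pp pm q s a b v φε x z := by
  refine le_trans ?_ (Gr_ge hε hpp hpm hφ ha hb z)
  have h0 := P_ge (v := v) hε hpp hpm hφ x
  exact (Real.rpow_le_rpow_of_exponent_ge hε.1 hε.2.le (P_le hε hpp hpm hφ x)).trans
    (Real.rpow_le_rpow hε.1.le (ell_ge z) (hε.1.le.trans h0))

lemma Gr_large {z : En n} (hz : 1 ≤ ‖z‖) : ‖z‖ ^ ε ≤ Gr ε pp pm q s a b v φε x z := by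
  refine le_trans ?_ (Gr_ge hε hpp hpm hφ ha hb z)
  have h1 := ell_ge_norm (ε := ε) z
  exact (Real.rpow_le_rpow (norm_nonneg _) h1 hε.1.le).trans
    (Real.rpow_le_rpow_of_exponent_le (hz.trans h1) (P_ge hε hpp hpm hφ x))

lemma Gr_ratio (hq : 0 ≤ q) (hs : 0 ≤ s) (z z' : En n) : Gr ε pp pm q s a b v φε x z ≤
    (1 + ‖z - z'‖ / ε) ^ (ε + pp + pm + q + s) * Gr ε pp pm q s a b v φε x z' := by
  set r := 1 + ‖z - z'‖ / ε with hr
  have hε0 := hε.1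
  have hr1 : 1 ≤ r := by rw [hr]; have : 0 ≤ ‖z - z'‖ / ε := by positivity
                         linarith
  have hl : 0 ≤ ellReg ε z := hε.1.le.trans (ell_ge z)
  have hl' : 0 ≤ ellReg ε z' := hε.1.le.trans (ell_ge z')
  have key : ∀ t, 0 ≤ t → t ≤ ε + pp + pm + q + s →
      ellReg ε z ^ t ≤ r ^ (ε + pp + pm + q + s) * ellReg ε z' ^ t := by
    intro t ht htQ
    calc _ ≤ (r * ellReg ε z') ^ t := Real.rpow_le_rpow hl (ell_ratio hε.1 z z') ht
      _ = r ^ t * ellReg ε z' ^ t := Real.mul_rpow (by linarith) hl'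
      _ ≤ _ := mul_le_mul_of_nonneg_right (Real.rpow_le_rpow_of_exponent_le hr1 htQ)
        (Real.rpow_nonneg hl' _)
  have h0 := P_ge (v := v) hε hpp hpm hφ x
  have h1 := P_le (v := v) hε hpp hpm hφ x
  have k1 := key _ (hε0.le.trans h0) (by linarith)
  have k2 := mul_le_mul_of_nonneg_left (key q hq (by linarith))
    (add_nonneg hε.1.le (mul_nonneg ha (chi_nonneg hφ {y | 0 < v y} x)))
  have k3 := mul_le_mul_of_nonneg_left (key s hs (by linarith))
    (add_nonneg hε.1.le (mul_nonneg hb (chi_nonneg hφ {y | v y < 0} x)))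
  unfold Gr
  nlinarith [k1, k2, k3]
end Gs

lemma inv_diff {g g' m t : ℝ} (hm : 0 < m) (hg : m ≤ g) (hg' : m ≤ g') (ht : 1 ≤ t)
    (h2 : g' ≤ t * g) : 1 / g - 1 / g' ≤ (t - 1) / m := by
  have hg0 : 0 < g := hm.trans_le hg
  have hg0' : 0 < g' := hm.trans_le hg'
  have e1 : 1 / g ≤ t / g' := by
    rw [div_le_div_iff₀ hg0 hg0']; linarith
  have e2 : (t - 1) / g' ≤ (t - 1) / m := div_le_div_of_nonneg_left (by linarith) hm hg'
  rw [sub_div] at e2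
  linarith

lemma quot_diff {f g g' m t M : ℝ} (hm : 0 < m) (hg : m ≤ g) (hg' : m ≤ g') (ht : 1 ≤ t)
    (h1 : g ≤ t * g') (h2 : g' ≤ t * g) (hf : |f| ≤ M) : |f / g - f / g'| ≤ M * ((t - 1) / m) := by
  have e : f / g - f / g' = f * (1 / g - 1 / g') := by ring
  rw [e, abs_mul]
  refine mul_le_mul hf ?_ (abs_nonneg _) ((abs_nonneg f).trans hf)
  rw [abs_le]
  have := inv_diff hm hg hg' ht h2
  have := inv_diff hm hg' hg ht h1
  constructor <;> linarith

end SK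

/-- comparison principle for the regularized equation
`G_ε(x, Du)(ε u + F(D²u)) = f(x)` in `Ω`. -/
theorem comparison_principle_regularized
    {n : ℕ} (hn : 2 ≤ n) (Ω : Set (En n)) (hΩo : IsOpen Ω) (hΩb : Bornology.IsBounded Ω)
    (lam Lam : ℝ) (hlam : 0 < lam) (hlL : lam ≤ Lam)
    (F : Mat n → ℝ) (hF : UniformlyElliptic lam Lam F) (hF0 : F 0 = 0)
    (pp pm q s : ℝ) (hpp : 0 ≤ pp) (hppq : pp ≤ q) (hpm : 0 ≤ pm) (hpms : pm ≤ s)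
    (a b : En n → ℝ) (hac : ContinuousOn a Ω) (ha0 : ∀ x ∈ Ω, 0 ≤ a x)
    (hbc : ContinuousOn b Ω) (hb0 : ∀ x ∈ Ω, 0 ≤ b x)
    (f : En n → ℝ) (hfc : ContinuousOn f Ω) (hfb : ∃ M, ∀ x ∈ Ω, |f x| ≤ M)
    (ε : ℝ) (hε : ε ∈ Set.Ioo (0:ℝ) 1)
    (v : En n → ℝ) (hvc : ContinuousOn v (closure Ω))
    (φε : En n → ℝ) (hφ : IsMollifier ε φε)
    (w₁ w₂ : En n → ℝ)
    (hw₁c : UpperSemicontinuousOn w₁ (closure Ω))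
    (hw₁ : ViscSubOn Ω (regOp F ε pp pm q s a b v f φε) w₁)
    (hw₂c : LowerSemicontinuousOn w₂ (closure Ω))
    (hw₂ : ViscSupOn Ω (regOp F ε pp pm q s a b v f φε) w₂)
    (hbdry : ∀ x ∈ frontier Ω, w₁ x ≤ w₂ x) :
    ∀ x ∈ Ω, w₁ x ≤ w₂ x := by
  obtain ⟨M0, hM0⟩ := hfb
  set M := max M0 0 with hMdef
  have hM : ∀ x ∈ Ω, |f x| ≤ M := fun x hx => (hM0 x hx).trans (le_max_left _ _)
  have hMn : 0 ≤ M := le_max_right _ _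
  have hq : 0 ≤ q := hpp.trans hppq
  have hs : 0 ≤ s := hpm.trans hpms
  set m := ε ^ (ε + pp + pm) with hm
  have hm0 : 0 < m := Real.rpow_pos_of_pos hε.1 _
  have hlow : ∀ x ∈ Ω, ∀ z, m ≤ Gr ε pp pm q s a b v φε x z := fun x hx z =>
    Gr_lower hε hpp hpm hφ (ha0 x hx) (hb0 x hx) z
  have hG : ∀ x ∈ Ω, ∀ z, 0 < Gr ε pp pm q s a b v φε x z := fun x hx z =>
    hm0.trans_le (hlow x hx z)
  have hJ1 := cp_jet1 hG hw₁
  have hJ2 := cp_jet2 hG hw₂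
  have key := cp_main (μ := (volume : Measure (En n))) (N := closure Ω) (H0 := M / m)
    hΩo subset_closure hΩb.isCompact_closure hw₁c hw₂c.neg hlam (cp_ell hF hF0) hJ1 hJ2 hε.1
    (by positivity) ?_ ?_ ?_ ?_
  · intro x hx
    have := key x hx
    simp only [Pi.neg_apply] at this
    linarith
  · intro y hy p
    rw [abs_div, abs_of_pos (hG y hy p)]
    exact div_le_div₀ hMn (hM y hy) hm0 (hlow y hy p)
  · intro e he
    have hc : ContinuousAt (fun κ : ℝ => M * (((1 + κ / ε) ^ (ε + pp + pm + q + s) - 1) / m)) 0 := by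
      have : ContinuousAt (fun κ : ℝ => (1 + κ / ε) ^ (ε + pp + pm + q + s)) 0 := by
        refine ContinuousAt.rpow_const (by fun_prop) (Or.inl ?_)
        simp
      fun_prop
    have hev : ∀ᶠ κ in 𝓝 (0:ℝ), M * (((1 + κ / ε) ^ (ε + pp + pm + q + s) - 1) / m) < e := by
      refine hc.eventually_lt continuousAt_const ?_
      simpa using he
    obtain ⟨κ, hκ, hball⟩ := Metric.eventually_nhds_iff.1 hev
    refine ⟨κ, hκ, fun y hy p p' hpp' => ?_⟩
    have hb' := hball (y := ‖p - p'‖) (by simpa using hpp')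
    refine le_trans ?_ hb'.le
    have r1 : 1 ≤ 1 + ‖p - p'‖ / ε := by
      have := div_nonneg (norm_nonneg (p - p')) hε.1.le
      linarith
    refine quot_diff hm0 (hlow y hy p) (hlow y hy p') (Real.one_le_rpow r1 ?_)
      (Gr_ratio hε hpp hpm hφ (ha0 y hy) (hb0 y hy) hq hs p p') ?_ (hM y hy)
    · have := hε.1; linarith
    · rw [norm_sub_rev p p']
      exact Gr_ratio hε hpp hpm hφ (ha0 y hy) (hb0 y hy) hq hs p' p
  · intro η hη e he
    have hη2 : ((η : ENNReal) / 2) ≠ 0 := by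
      simp [hη.ne']
    obtain ⟨K1, h1s, h1c, h1m, h1⟩ := chi_lusin hφ {y | 0 < v y} hΩo hΩb hη2
    obtain ⟨K2, h2s, h2c, h2m, h2⟩ := chi_lusin hφ {y | v y < 0} hΩo hΩb hη2
    have hKc : IsCompact (K1 ∩ K2) := h1c.inter h2c
    refine ⟨K1 ∩ K2, hKc.isClosed, ?_, ?_⟩
    · rw [sdiff_inter]
      exact (measure_union_le _ _).trans ((add_le_add h1m h2m).trans (ENNReal.add_halves _).le)
    have hlim : ∀ᶠ R : ℝ in Filter.atTop, 2 * M / e ≤ R ^ ε :=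
      (tendsto_rpow_atTop hε.1).eventually_ge_atTop _
    obtain ⟨R, hR, hR1⟩ := (hlim.and (Filter.eventually_ge_atTop 1)).exists
    have hcont : ContinuousOn (fun w : En n × En n => f w.1 / Gr ε pp pm q s a b v φε w.1 w.2)
        ((K1 ∩ K2) ×ˢ closedBall 0 R) := by
      have hfst : MapsTo (Prod.fst : En n × En n → En n) ((K1 ∩ K2) ×ˢ closedBall 0 R) (K1 ∩ K2) :=
        fun w hw => hw.1
      have hK : K1 ∩ K2 ⊆ Ω := inter_subset_left.trans h1s
      have c1 := (h1.mono inter_subset_left).comp continuousOn_fst hfst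
      have c2 := (h2.mono inter_subset_right).comp continuousOn_fst hfst
      have ca := (hac.mono hK).comp continuousOn_fst hfst
      have cb := (hbc.mono hK).comp continuousOn_fst hfst
      have cf := (hfc.mono hK).comp continuousOn_fst hfst
      have cl : ContinuousOn (fun w : En n × En n => ellReg ε w.2) ((K1 ∩ K2) ×ˢ closedBall 0 R) :=
        (ell_cont.comp continuous_snd).continuousOn
      have hl0 : ∀ w : En n × En n, ellReg ε w.2 ≠ 0 := fun w => (hε.1.trans_le (ell_ge w.2)).ne'
      refine cf.div ?_ fun w hw => (hG w.1 (hK hw.1) w.2).ne'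
      unfold Gr
      refine ((cl.rpow ((continuousOn_const.add (continuousOn_const.mul c1)).add
        (continuousOn_const.mul c2)) fun w _ => Or.inl (hl0 w)).add
        ((continuousOn_const.add (ca.mul c1)).mul (cl.rpow_const fun w _ => Or.inl (hl0 w)))).add
        ((continuousOn_const.add (cb.mul c2)).mul (cl.rpow_const fun w _ => Or.inl (hl0 w)))
    have huc := (hKc.prod (isCompact_closedBall (0 : En n) R)).uniformContinuousOn_of_continuous hcont
    obtain ⟨ρ, hρ, hunif⟩ := Metric.uniformContinuousOn_iff.1 huc e he
    refine ⟨ρ, hρ, fun y hy y' hy' hyy p => ?_⟩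
    by_cases hp : ‖p‖ ≤ R
    · have := hunif (y, p) ⟨hy.1, by simpa using hp⟩ (y', p) ⟨hy'.1, by simpa using hp⟩
        (by simpa [Prod.dist_eq, dist_eq_norm, hρ] using hyy)
      rw [Real.dist_eq] at this
      exact this.le
    · push Not at hp
      have hsm : ∀ x ∈ Ω, |f x / Gr ε pp pm q s a b v φε x p| ≤ e / 2 := by
        intro x hx
        rw [abs_div, abs_of_pos (hG x hx p), div_le_iff₀ (hG x hx p)]
        have g1 := Gr_large (q := q) (s := s) (v := v) hε hpp hpm hφ (ha0 x hx) (hb0 x hx) (hR1.trans hp.le)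
        have g2 : R ^ ε ≤ ‖p‖ ^ ε := Real.rpow_le_rpow (by linarith) hp.le hε.1.le
        rw [div_le_iff₀ he] at hR
        have g3 := hM x hx
        nlinarith [mul_le_mul_of_nonneg_left (g2.trans g1) he.le]
      refine (abs_sub _ _).trans ?_
      linarith [hsm y hy.2, hsm y' hy'.2]
  · intro y hy hyΩ
    have : y ∈ frontier Ω := by
      rw [hΩo.frontier_eq]; exact ⟨hy, hyΩ⟩
    have := hbdry y this
    simp only [Pi.neg_apply]
    linarith
end
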